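/- arXiv:1401.4751 — 17 statements merged into one kernel-verified Lean document; each statement's English description precedes it below -/
import Mathlib

section
/- As h → 0⁺, the normalized chord length (t(h) − s(h))/√h tends to 2√2/√(f''(0)); that is, if L_P(h) denotes the length of the chord cut from the graph of f by the horizontal line y = h, then lim_{h→0⁺} L_P(h)/√h = 2√2/√κ, where κ = f''(0) is the curvature of the graph at the origin. -/
open Real Filter Set

theorem quad_lim (p q : ℝ) (hp : p < 0) (hq : 0 < q)
    (f : ℝ → ℝ) (hf : ContDiffOn ℝ 3 f (Set.Ioo p q))
    (hf0 : f 0 = 0) (hf'0 : deriv f 0 = 0)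
    (hc : 0 < deriv (deriv f) 0) :
    Tendsto (fun x => f x / x ^ 2) (nhdsWithin 0 {0}ᶜ) (nhds (deriv (deriv f) 0 / 2)) := by
  have hdd : DifferentiableAt ℝ (deriv f) 0 := differentiableAt_of_deriv_ne_zero hc.ne'
  have hnb : Ioo p q ∈ nhds (0:ℝ) := Ioo_mem_nhds hp hq
  have hdf : ∀ x ∈ Ioo p q, DifferentiableAt ℝ f x := fun x hx =>
    (hf.differentiableOn (by norm_num)).differentiableAt (Ioo_mem_nhds hx.1 hx.2)
  have hcont : Tendsto f (nhdsWithin 0 {0}ᶜ) (nhds 0) := by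
    have := (hdf 0 ⟨hp, hq⟩).continuousAt.tendsto
    rw [hf0] at this
    exact this.mono_left nhdsWithin_le_nhds
  have hsq : Tendsto (fun x : ℝ => x ^ 2) (nhdsWithin 0 {0}ᶜ) (nhds 0) := by
    have : Tendsto (fun x : ℝ => x ^ 2) (nhds 0) (nhds (0 ^ 2)) :=
      (continuous_pow 2).tendsto 0
    simp only [ne_eq, OfNat.ofNat_ne_zero, not_false_eq_true, zero_pow] at this
    exact this.mono_left nhdsWithin_le_nhds
  refine HasDerivAt.lhopital_zero_nhdsNE (f' := deriv f) (g' := fun x => 2 * x)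
    ?_ ?_ ?_ hcont hsq ?_
  · filter_upwards [nhdsWithin_le_nhds hnb] with x hx using (hdf x hx).hasDerivAt
  · exact Eventually.of_forall fun x => by simpa using hasDerivAt_pow 2 x
  · filter_upwards [self_mem_nhdsWithin] with x hx
    have : x ≠ 0 := hx
    positivity
  · have h1 := (hasDerivAt_iff_tendsto_slope.1 hdd.hasDerivAt).div_const 2
    refine h1.congr' ?_
    filter_upwards [self_mem_nhdsWithin] with x hx
    have : x ≠ 0 := hx
    simp only [slope_def_field, hf'0, sub_zero]
    field_simp

theorem branch_lim (f : ℝ → ℝ) (c : ℝ) (hc : 0 < c)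
    (hl : Tendsto (fun x => f x / x ^ 2) (nhdsWithin 0 {0}ᶜ) (nhds (c / 2)))
    (u : ℝ → ℝ) (hu0 : Tendsto u (nhdsWithin 0 (Ioi 0)) (nhds 0))
    (hu : ∀ᶠ h in nhdsWithin 0 (Ioi 0), u h ≠ 0 ∧ f (u h) = h) :
    Tendsto (fun h => |u h| / √h) (nhdsWithin 0 (Ioi 0)) (nhds (√2 / √c)) := by
  have h1 : Tendsto u (nhdsWithin 0 (Ioi 0)) (nhdsWithin 0 {0}ᶜ) :=
    tendsto_nhdsWithin_iff.2 ⟨hu0, hu.mono fun h hh => hh.1⟩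
  have h2 := ((hl.comp h1).sqrt).inv₀ (by positivity)
  have e : (√(c / 2))⁻¹ = √2 / √c := by
    rw [Real.sqrt_div hc.le, inv_div]
  rw [e] at h2
  refine h2.congr' ?_
  filter_upwards [hu, self_mem_nhdsWithin] with h hh hpos
  have hpos : 0 < h := hpos
  simp only [Function.comp, hh.2]
  rw [Real.sqrt_div hpos.le, Real.sqrt_sq_eq_abs, inv_div]

theorem stmt_0 (p q : ℝ) (hp : p < 0) (hq : 0 < q)
    (f : ℝ → ℝ) (hf : ContDiffOn ℝ 3 f (Set.Ioo p q))
    (hf0 : f 0 = 0) (hf'0 : deriv f 0 = 0)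
    (hconv : ∀ x ∈ Set.Ioo p q, 0 < deriv (deriv f) x)
    (ε : ℝ) (hε : 0 < ε) (s t : ℝ → ℝ)
    (hst : ∀ h ∈ Set.Ioo (0:ℝ) ε, s h ∈ Set.Ioo p q ∧ t h ∈ Set.Ioo p q ∧
      s h < 0 ∧ 0 < t h ∧ f (s h) = h ∧ f (t h) = h)
    (hs0 : Filter.Tendsto s (nhdsWithin 0 (Set.Ioi 0)) (nhds 0))
    (ht0 : Filter.Tendsto t (nhdsWithin 0 (Set.Ioi 0)) (nhds 0)) :
    Filter.Tendsto (fun h => (t h - s h) / Real.sqrt h) (nhdsWithin 0 (Set.Ioi 0))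
      (nhds (2 * Real.sqrt 2 / Real.sqrt (deriv (deriv f) 0))) := by
  have hc := hconv 0 ⟨hp, hq⟩
  have hl := quad_lim p q hp hq f hf hf0 hf'0 hc
  have hev : ∀ᶠ h in nhdsWithin (0:ℝ) (Ioi 0), h ∈ Ioo (0:ℝ) ε := Ioo_mem_nhdsGT hε
  have hS := branch_lim f _ hc hl s hs0 (hev.mono fun h hh =>
    ⟨(hst h hh).2.2.1.ne, (hst h hh).2.2.2.2.1⟩)
  have hT := branch_lim f _ hc hl t ht0 (hev.mono fun h hh =>
    ⟨(hst h hh).2.2.2.1.ne', (hst h hh).2.2.2.2.2⟩)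
  have hsum := hT.add hS
  have e : √2 / √(deriv (deriv f) 0) + √2 / √(deriv (deriv f) 0)
      = 2 * √2 / √(deriv (deriv f) 0) := by ring
  rw [e] at hsum
  refine hsum.congr' ?_
  filter_upwards [hev] with h hh
  rw [abs_of_pos (hst h hh).2.2.2.1, abs_of_neg (hst h hh).2.2.1]
  ring
end

section
/- As h → 0⁺, the quotient T_P(h)/(h√h) tends to √2/√(f''(0)), where T_P(h) := (h/2)(t(h) − s(h)) is the area of the triangle with vertices (0,0), (s(h),h), (t(h),h); that is, lim_{h→0⁺} T_P(h)/(h√h) = √2/√κ with κ = f''(0) the curvature of the graph of f at the origin. -/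
open Real Filter Set

theorem stmt_1 (p q : ℝ) (hp : p < 0) (hq : 0 < q)
    (f : ℝ → ℝ) (hf : ContDiffOn ℝ 3 f (Set.Ioo p q))
    (hf0 : f 0 = 0) (hf'0 : deriv f 0 = 0)
    (hconv : ∀ x ∈ Set.Ioo p q, 0 < deriv (deriv f) x)
    (ε : ℝ) (hε : 0 < ε) (s t : ℝ → ℝ)
    (hst : ∀ h ∈ Set.Ioo (0:ℝ) ε, s h ∈ Set.Ioo p q ∧ t h ∈ Set.Ioo p q ∧
      s h < 0 ∧ 0 < t h ∧ f (s h) = h ∧ f (t h) = h)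
    (hs0 : Filter.Tendsto s (nhdsWithin 0 (Set.Ioi 0)) (nhds 0))
    (ht0 : Filter.Tendsto t (nhdsWithin 0 (Set.Ioi 0)) (nhds 0)) :
    Filter.Tendsto (fun h => (h/2 * (t h - s h)) / (h * Real.sqrt h)) (nhdsWithin 0 (Set.Ioi 0))
      (nhds (Real.sqrt 2 / Real.sqrt (deriv (deriv f) 0))) := by
  set κ := deriv (deriv f) 0 with hκ
  have hκpos : 0 < κ := hconv 0 ⟨hp, hq⟩
  have hd2 : HasDerivAt (deriv f) κ 0 :=
    (differentiableAt_of_deriv_ne_zero hκpos.ne').hasDerivAt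
  have hnhds : Set.Ioo p q ∈ nhds (0:ℝ) := Ioo_mem_nhds hp hq
  have hdf : ∀ x ∈ Set.Ioo p q, DifferentiableAt ℝ f x := fun x hx =>
    (hf.differentiableOn (by norm_num)).differentiableAt (isOpen_Ioo.mem_nhds hx)
  have hquot : Tendsto (fun x => f x / x ^ 2) (nhdsWithin 0 {0}ᶜ) (nhds (κ / 2)) := by
    refine HasDerivAt.lhopital_zero_nhdsNE (f' := deriv f) (g' := fun x => 2 * x) ?_ ?_ ?_ ?_ ?_ ?_
    · filter_upwards [nhdsWithin_le_nhds hnhds] with x hx using (hdf x hx).hasDerivAt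
    · filter_upwards with x
      simpa using hasDerivAt_pow 2 x
    · filter_upwards [self_mem_nhdsWithin] with x hx
      simpa using hx
    · have := (hdf 0 ⟨hp, hq⟩).continuousAt.tendsto
      rw [hf0] at this
      exact this.mono_left nhdsWithin_le_nhds
    · have : Tendsto (fun x : ℝ => x ^ 2) (nhds 0) (nhds (0 ^ 2)) :=
        (continuous_pow 2).tendsto 0
      simp only [ne_eq, OfNat.ofNat_ne_zero, not_false_eq_true, zero_pow] at this
      exact this.mono_left nhdsWithin_le_nhds
    · have := (hasDerivAt_iff_tendsto_slope.1 hd2).div_const 2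
      refine this.congr fun x => ?_
      rw [slope_def_field, hf'0]
      simp only [sub_zero]
      rw [div_div, mul_comm]
  have hmain : Tendsto (fun x => |x| / √(f x)) (nhdsWithin 0 {0}ᶜ) (nhds (√2 / √κ)) := by
    have h1 := (hquot.inv₀ (by positivity)).sqrt
    have e : √((κ / 2)⁻¹) = √2 / √κ := by
      rw [inv_div, Real.sqrt_div (by norm_num)]
    rw [e] at h1
    refine h1.congr fun x => ?_
    rw [inv_div, Real.sqrt_div (sq_nonneg x), Real.sqrt_sq_eq_abs]
  have hev : ∀ᶠ h in nhdsWithin (0:ℝ) (Set.Ioi 0), h ∈ Set.Ioo (0:ℝ) ε :=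
    Ioo_mem_nhdsGT hε
  have hs1 := hmain.comp (tendsto_nhdsWithin_iff.2 ⟨hs0, by
    filter_upwards [hev] with h hh using (hst h hh).2.2.1.ne⟩)
  have ht1 := hmain.comp (tendsto_nhdsWithin_iff.2 ⟨ht0, by
    filter_upwards [hev] with h hh using (hst h hh).2.2.2.1.ne'⟩)
  have hsum := (ht1.add hs1).div_const 2
  rw [add_self_div_two] at hsum
  refine hsum.congr' ?_
  filter_upwards [hev] with h hh
  obtain ⟨-, -, h1, h2, h3, h4⟩ := hst h hh
  have hpos : 0 < h := hh.1
  have hsq : 0 < √h := Real.sqrt_pos.2 hpos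
  simp only [Function.comp, h3, h4, abs_of_neg h1, abs_of_pos h2]
  field_simp
  try ring
end

section
/- As h → 0⁺, the quotient U_P(h)/(h√h) tends to √2/(2√(f''(0))); that is, lim_{h→0⁺} U_P(h)/(h√h) = √2/(2√κ), where κ = f''(0) is the curvature of the graph of f at the origin. -/
open Real Filter Set

theorem stmt_2 (p q : ℝ) (hp : p < 0) (hq : 0 < q)
    (f : ℝ → ℝ) (hf : ContDiffOn ℝ 3 f (Set.Ioo p q))
    (hf0 : f 0 = 0) (hf'0 : deriv f 0 = 0)
    (hconv : ∀ x ∈ Set.Ioo p q, 0 < deriv (deriv f) x)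
    (ε : ℝ) (hε : 0 < ε) (s t : ℝ → ℝ)
    (hst : ∀ h ∈ Set.Ioo (0:ℝ) ε, s h ∈ Set.Ioo p q ∧ t h ∈ Set.Ioo p q ∧
      s h < 0 ∧ 0 < t h ∧ f (s h) = h ∧ f (t h) = h)
    (hs0 : Filter.Tendsto s (nhdsWithin 0 (Set.Ioi 0)) (nhds 0))
    (ht0 : Filter.Tendsto t (nhdsWithin 0 (Set.Ioi 0)) (nhds 0)) :
    Filter.Tendsto (fun h => (((1:ℝ)/2) * (h^2 * (deriv f (t h) - deriv f (s h)) / (-(deriv f (s h) * deriv f (t h))) - 2*h*(t h - s h) + (-(deriv f (s h) * deriv f (t h))) * (t h - s h)^2 / (deriv f (t h) - deriv f (s h)))) / (h * Real.sqrt h)) (nhdsWithin 0 (Set.Ioi 0))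
      (nhds (Real.sqrt 2 / (2 * Real.sqrt (deriv (deriv f) 0)))) := by
  set k := deriv (deriv f) 0 with hk
  have hkpos : 0 < k := hconv 0 ⟨hp, hq⟩
  have hnhds : Set.Ioo p q ∈ nhds (0:ℝ) := Ioo_mem_nhds hp hq
  have hdf : ∀ᶠ x in nhds (0:ℝ), DifferentiableAt ℝ f x := by
    filter_upwards [hnhds] with x hx
    exact (hf.differentiableOn (by norm_num)).differentiableAt (Ioo_mem_nhds hx.1 hx.2)
  have hd2 : HasDerivAt (deriv f) k 0 :=
    (differentiableAt_of_deriv_ne_zero hkpos.ne').hasDerivAt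
  have L1 : Tendsto (fun x => deriv f x / x) (nhdsWithin 0 {0}ᶜ) (nhds k) := by
    have := hasDerivAt_iff_tendsto_slope.1 hd2
    refine this.congr fun x => ?_
    simp [slope_def_field, hf'0]
  have L2 : Tendsto (fun x => f x / x ^ 2) (nhdsWithin 0 {0}ᶜ) (nhds (k / 2)) := by
    have hne : ∀ᶠ x in nhdsWithin (0:ℝ) {0}ᶜ, x ≠ 0 := self_mem_nhdsWithin
    refine HasDerivAt.lhopital_zero_nhdsNE (f' := deriv f) (g' := fun x => 2 * x) ?_ ?_ ?_ ?_ ?_ ?_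
    · exact (hdf.filter_mono nhdsWithin_le_nhds).mono fun x hx => hx.hasDerivAt
    · exact Eventually.of_forall fun x => by simpa using hasDerivAt_pow 2 x
    · filter_upwards [hne] with x hx
      simpa using hx
    · have := hdf.self_of_nhds.continuousAt.tendsto
      rw [hf0] at this
      exact this.mono_left nhdsWithin_le_nhds
    · have : Tendsto (fun x : ℝ => x ^ 2) (nhds 0) (nhds (0 ^ 2)) :=
        (continuous_pow 2).tendsto 0
      simp only [ne_eq, OfNat.ofNat_ne_zero, not_false_eq_true, zero_pow] at this
      exact this.mono_left nhdsWithin_le_nhds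
    · refine (L1.div_const 2).congr fun x => ?_
      rw [div_div, mul_comm]
  have hev : ∀ᶠ h in nhdsWithin (0:ℝ) (Set.Ioi 0), h ∈ Set.Ioo (0:ℝ) ε := Ioo_mem_nhdsGT hε
  have key : ∀ u : ℝ → ℝ, Tendsto u (nhdsWithin 0 (Set.Ioi 0)) (nhds 0) →
      (∀ h ∈ Set.Ioo (0:ℝ) ε, u h ≠ 0 ∧ f (u h) = h) →
      Tendsto (fun h => |u h| / √h) (nhdsWithin 0 (Set.Ioi 0)) (nhds (√(2 / k))) ∧
      Tendsto (fun h => deriv f (u h) / u h) (nhdsWithin 0 (Set.Ioi 0)) (nhds k) := by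
    intro u hu hu'
    have hu2 : Tendsto u (nhdsWithin 0 (Set.Ioi 0)) (nhdsWithin 0 {0}ᶜ) :=
      tendsto_nhdsWithin_iff.2 ⟨hu, hev.mono fun h hh => (hu' h hh).1⟩
    refine ⟨?_, L1.comp hu2⟩
    have h1 := ((L2.comp hu2).inv₀ (by positivity)).sqrt
    rw [inv_div] at h1
    refine h1.congr' ?_
    filter_upwards [hev] with h hh
    simp only [Function.comp, (hu' h hh).2, inv_div]
    rw [Real.sqrt_div (sq_nonneg _), Real.sqrt_sq_eq_abs]
  obtain ⟨T, A⟩ := key t ht0 fun h hh => by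
    obtain ⟨_, _, _, h1, _, h2⟩ := hst h hh
    exact ⟨h1.ne', h2⟩
  obtain ⟨S, B⟩ := key s hs0 fun h hh => by
    obtain ⟨_, _, h1, _, h2, _⟩ := hst h hh
    exact ⟨h1.ne, h2⟩
  set c := √(2 / k) with hc
  have hcpos : 0 < c := by positivity
  have hc2 : k * c ^ 2 = 2 := by
    rw [hc, Real.sq_sqrt (by positivity)]; field_simp
  have A' := A.mul T
  have B' := (B.mul S).neg
  have AB := (A'.mul B').neg
  have AmB := A'.sub B'
  have TS := T.add S
  have hlim := (((AmB.div AB (by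
      have : 0 < k * c * (k * c) := by positivity
      nlinarith)).sub (TS.const_mul 2)).add
    ((AB.mul (TS.pow 2)).div AmB (by
      have : 0 < k * c := by positivity
      linarith))).const_mul ((1:ℝ)/2)
  have hval : √2 / (2 * √k) = 1 / 2 * ((k * c - -(k * c)) / -(k * c * -(k * c)) - 2 * (c + c)
      + -(k * c * -(k * c)) * (c + c) ^ 2 / (k * c - -(k * c))) := by
    have e1 : √2 / (2 * √k) = c / 2 := by
      rw [hc, Real.sqrt_div (by norm_num)]; field_simp
    rw [e1]
    have hk' : k = 2 / c ^ 2 := by field_simp; linarith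
    rw [hk']
    field_simp
    ring
  rw [hval]
  refine hlim.congr' ?_
  filter_upwards [hev] with h hh
  obtain ⟨_, _, hs, ht, _, _⟩ := hst h hh
  have hh0 : 0 < h := hh.1
  simp only [Pi.div_apply]
  rw [abs_of_neg hs, abs_of_pos ht]
  obtain ⟨r, hr, hr2⟩ : ∃ r, 0 < r ∧ h = r ^ 2 :=
    ⟨√h, Real.sqrt_pos.2 hh0, (Real.sq_sqrt hh0.le).symm⟩
  have hrs : √h = r := by rw [hr2, Real.sqrt_sq hr.le]
  rw [hrs]
  have eA : deriv f (t h) / t h * (t h / r) = deriv f (t h) / r := by field_simp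
  have hs' := hs.ne
  have eB : -(deriv f (s h) / s h * (-s h / r)) = deriv f (s h) / r := by field_simp
  have eT : t h / r + -s h / r = (t h - s h) / r := by ring
  rw [eA, eB, eT, ← sub_div]
  generalize deriv f (t h) = a
  generalize deriv f (s h) = b
  generalize t h - s h = w
  have e1 : (a - b) / r / -(a / r * (b / r)) = r * ((a - b) / (-(b * a))) := by
    rw [show -(a / r * (b / r)) = -(b * a) / r ^ 2 by field_simp, div_div_div_eq,
      show (a - b) * r ^ 2 / (r * -(b * a)) = (r / r) * (r * ((a - b) / (-(b * a)))) by ring,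
      div_self hr.ne', one_mul]
  have e2 : -(a / r * (b / r)) * (w / r) ^ 2 / ((a - b) / r)
      = (-(b * a) * w ^ 2 / (a - b)) / r ^ 3 := by
    rw [div_div_eq_mul_div]
    generalize (a - b) = d
    rw [show -(a / r * (b / r)) * (w / r) ^ 2 * r / d = (-(b * a) * w ^ 2 / d) * ((r / r) / r ^ 3) by
      ring, div_self hr.ne']
    ring
  rw [e1, e2, hr2, mul_div_assoc ((r ^ 2) ^ 2)]
  generalize (a - b) / (-(b * a)) = X
  generalize -(b * a) * w ^ 2 / (a - b) = Y
  field_simp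
end

section
/- As h → 0⁺, the quantity α_P(h) := √h · (f'(t(h)) − f'(s(h)))/(−f'(s(h)) f'(t(h))) tends to √2/√(f''(0)), i.e. lim_{h→0⁺} α_P(h) = √2/√κ where κ = f''(0) is the curvature of the graph of f at the origin. -/
open Real Filter Set

theorem stmt_3 (p q : ℝ) (hp : p < 0) (hq : 0 < q)
    (f : ℝ → ℝ) (hf : ContDiffOn ℝ 3 f (Set.Ioo p q))
    (hf0 : f 0 = 0) (hf'0 : deriv f 0 = 0)
    (hconv : ∀ x ∈ Set.Ioo p q, 0 < deriv (deriv f) x)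
    (ε : ℝ) (hε : 0 < ε) (s t : ℝ → ℝ)
    (hst : ∀ h ∈ Set.Ioo (0:ℝ) ε, s h ∈ Set.Ioo p q ∧ t h ∈ Set.Ioo p q ∧
      s h < 0 ∧ 0 < t h ∧ f (s h) = h ∧ f (t h) = h)
    (hs0 : Filter.Tendsto s (nhdsWithin 0 (Set.Ioi 0)) (nhds 0))
    (ht0 : Filter.Tendsto t (nhdsWithin 0 (Set.Ioi 0)) (nhds 0)) :
    Filter.Tendsto (fun h => Real.sqrt h * ((deriv f (t h) - deriv f (s h)) / (-(deriv f (s h) * deriv f (t h)))))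
      (nhdsWithin 0 (Set.Ioi 0)) (nhds (Real.sqrt 2 / Real.sqrt (deriv (deriv f) 0))) := by
  have hO : IsOpen (Set.Ioo p q) := isOpen_Ioo
  have h0 : (0:ℝ) ∈ Set.Ioo p q := ⟨hp, hq⟩
  have hf1 : ContDiffOn ℝ 2 (deriv f) (Set.Ioo p q) :=
    hf.deriv_of_isOpen hO (by norm_num)
  have hf2 : ContDiffOn ℝ 1 (deriv (deriv f)) (Set.Ioo p q) :=
    hf1.deriv_of_isOpen hO (by norm_num)
  have hd0 : ∀ x ∈ Set.Ioo p q, HasDerivAt f (deriv f x) x := fun x hx =>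
    ((hf.differentiableOn (by norm_num)).differentiableAt (hO.mem_nhds hx)).hasDerivAt
  have hd1 : ∀ x ∈ Set.Ioo p q, HasDerivAt (deriv f) (deriv (deriv f) x) x := fun x hx =>
    ((hf1.differentiableOn (by norm_num)).differentiableAt (hO.mem_nhds hx)).hasDerivAt
  have hc2 : ContinuousAt (deriv (deriv f)) 0 := hf2.continuousOn.continuousAt (hO.mem_nhds h0)
  have hk := hconv 0 h0
  have hmono : StrictMonoOn (deriv f) (Set.Ioo p q) := by
    apply strictMonoOn_of_deriv_pos (convex_Ioo p q) hf1.continuousOn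
    rw [interior_Ioo]; exact hconv
  have hev : ∀ᶠ x in nhdsWithin (0:ℝ) {0}ᶜ, x ∈ Set.Ioo p q :=
    nhdsWithin_le_nhds (hO.mem_nhds h0)
  have hne : ∀ᶠ x in nhdsWithin (0:ℝ) {0}ᶜ, deriv f x ≠ 0 := by
    filter_upwards [hev, self_mem_nhdsWithin] with x hx hx0 h
    exact hx0 (hmono.injOn hx h0 (h.trans hf'0.symm))
  have key : Tendsto (fun x => (deriv f x)^2 / f x) (nhdsWithin (0:ℝ) {0}ᶜ)
      (nhds (2 * deriv (deriv f) 0)) := by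
    apply HasDerivAt.lhopital_zero_nhdsNE (f' := fun x => 2 * deriv f x * deriv (deriv f) x)
      (g' := deriv f)
    · filter_upwards [hev] with x hx
      have := (hd1 x hx).fun_pow 2
      simpa using this
    · filter_upwards [hev] with x hx using hd0 x hx
    · exact hne
    · have h3 : Tendsto (deriv f) (nhds 0) (nhds 0) := by
        have := (hd1 0 h0).continuousAt.tendsto
        rwa [hf'0] at this
      have h4 : Tendsto (fun x => (deriv f x)^2) (nhds 0) (nhds 0) := by simpa using h3.pow 2
      exact h4.mono_left nhdsWithin_le_nhds
    · have := (hd0 0 h0).continuousAt.tendsto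
      rw [hf0] at this
      exact this.mono_left nhdsWithin_le_nhds
    · have : Tendsto (fun x => 2 * deriv (deriv f) x) (nhdsWithin (0:ℝ) {0}ᶜ)
        (nhds (2 * deriv (deriv f) 0)) := (hc2.tendsto.const_mul 2).mono_left nhdsWithin_le_nhds
      refine this.congr' ?_
      filter_upwards [hne] with x hx
      field_simp
  have key2 : Tendsto (fun x => √(f x) / |deriv f x|) (nhdsWithin (0:ℝ) {0}ᶜ)
      (nhds (√(2 * deriv (deriv f) 0))⁻¹) := by
    have h1 := (Real.continuous_sqrt.tendsto _).comp key
    have h2 := h1.inv₀ (by positivity)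
    refine h2.congr fun x => ?_
    simp only [Function.comp]
    rw [Real.sqrt_div (sq_nonneg _), Real.sqrt_sq_eq_abs, inv_div]
  have hI : ∀ᶠ h in nhdsWithin (0:ℝ) (Set.Ioi 0), h ∈ Set.Ioo (0:ℝ) ε := Ioo_mem_nhdsGT hε
  have hs1 : Tendsto s (nhdsWithin 0 (Set.Ioi 0)) (nhdsWithin (0:ℝ) {0}ᶜ) :=
    tendsto_nhdsWithin_iff.2 ⟨hs0, hI.mono fun h hh => (hst h hh).2.2.1.ne⟩
  have ht1 : Tendsto t (nhdsWithin 0 (Set.Ioi 0)) (nhdsWithin (0:ℝ) {0}ᶜ) :=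
    tendsto_nhdsWithin_iff.2 ⟨ht0, hI.mono fun h hh => (hst h hh).2.2.2.1.ne'⟩
  have hsum := (key2.comp hs1).add (key2.comp ht1)
  have hval : (√(2 * deriv (deriv f) 0))⁻¹ + (√(2 * deriv (deriv f) 0))⁻¹
      = √2 / √(deriv (deriv f) 0) := by
    rw [Real.sqrt_mul (by norm_num)]
    have h2 : √2 * √2 = (2:ℝ) := Real.mul_self_sqrt (by norm_num)
    have : 0 < √(deriv (deriv f) 0) := Real.sqrt_pos.2 hk
    have : 0 < √(2:ℝ) := by positivity
    field_simp
    nlinarith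
  rw [hval] at hsum
  refine hsum.congr' ?_
  filter_upwards [hI] with h hh
  obtain ⟨a, b, c, d, e, g⟩ := hst h hh
  have hsn : deriv f (s h) < 0 := hf'0 ▸ hmono a h0 c
  have htp : 0 < deriv f (t h) := by
    have := hmono h0 b d
    rwa [hf'0] at this
  simp only [Function.comp, e, g]
  rw [abs_of_neg hsn, abs_of_pos htp]
  have := hsn.ne
  have := htp.ne'
  field_simp
  ring
end

section
/- As h → 0⁺, the quotient t(h)/√h tends to 1/√a, where a = f''(0)/2. -/
open Real Filter Set

theorem stmt_4 (p q : ℝ) (hp : p < 0) (hq : 0 < q)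
    (f : ℝ → ℝ) (hf : ContDiffOn ℝ 3 f (Set.Ioo p q))
    (hf0 : f 0 = 0) (hf'0 : deriv f 0 = 0)
    (hconv : ∀ x ∈ Set.Ioo p q, 0 < deriv (deriv f) x)
    (ε : ℝ) (hε : 0 < ε) (s t : ℝ → ℝ)
    (hst : ∀ h ∈ Set.Ioo (0:ℝ) ε, s h ∈ Set.Ioo p q ∧ t h ∈ Set.Ioo p q ∧
      s h < 0 ∧ 0 < t h ∧ f (s h) = h ∧ f (t h) = h)
    (hs0 : Filter.Tendsto s (nhdsWithin 0 (Set.Ioi 0)) (nhds 0))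
    (ht0 : Filter.Tendsto t (nhdsWithin 0 (Set.Ioi 0)) (nhds 0)) :
    Filter.Tendsto (fun h => t h / Real.sqrt h) (nhdsWithin 0 (Set.Ioi 0))
      (nhds (1 / Real.sqrt (deriv (deriv f) 0 / 2))) := by 
  have h0 : (0:ℝ) ∈ Set.Ioo p q := ⟨hp, hq⟩
  have ha : 0 < deriv (deriv f) 0 := hconv 0 h0
  have hd2 : HasDerivAt (deriv f) (deriv (deriv f) 0) 0 :=
    (differentiableAt_of_deriv_ne_zero ha.ne').hasDerivAt
  have hd : ∀ x ∈ Set.Ioo p q, DifferentiableAt ℝ f x := fun x hx =>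
    (hf.differentiableOn (by norm_num)).differentiableAt (isOpen_Ioo.mem_nhds hx)
  have hle : nhdsWithin (0:ℝ) (Set.Ioi 0) ≤ nhds 0 := nhdsWithin_le_nhds
  have hev : ∀ᶠ x in nhdsWithin (0:ℝ) (Set.Ioi 0), x ∈ Set.Ioo p q :=
    hle (isOpen_Ioo.mem_nhds h0)
  have hpos : ∀ᶠ x in nhdsWithin (0:ℝ) (Set.Ioi 0), 0 < x := self_mem_nhdsWithin
  have key : Filter.Tendsto (fun x => f x / x ^ 2) (nhdsWithin 0 (Set.Ioi 0))
      (nhds (deriv (deriv f) 0 / 2)) := by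
    apply HasDerivAt.lhopital_zero_nhdsGT (f' := deriv f) (g' := fun x => 2 * x)
    · filter_upwards [hev] with x hx using (hd x hx).hasDerivAt
    · filter_upwards with x
      simpa using hasDerivAt_pow 2 x
    · filter_upwards [hpos] with x hx
      positivity
    · have := (hd 0 h0).continuousAt.tendsto
      rw [hf0] at this
      exact this.mono_left hle
    · have : Filter.Tendsto (fun x : ℝ => x ^ 2) (nhds 0) (nhds (0 ^ 2)) :=
        (continuous_pow 2).tendsto 0
      simp only [ne_eq, OfNat.ofNat_ne_zero, not_false_eq_true, zero_pow] at this
      exact this.mono_left hle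
    · have h1 := (hasDerivAt_iff_tendsto_slope.1 hd2).mono_left
        (nhdsWithin_mono 0 (fun x (hx : 0 < x) => hx.ne'))
      refine (h1.div_const 2).congr' ?_
      filter_upwards [hpos] with x hx
      simp only [slope_def_field, hf'0, sub_zero]
      field_simp
  have hI : ∀ᶠ h in nhdsWithin (0:ℝ) (Set.Ioi 0), h ∈ Set.Ioo 0 ε :=
    Ioo_mem_nhdsGT hε
  have htt : Filter.Tendsto t (nhdsWithin 0 (Set.Ioi 0)) (nhdsWithin 0 (Set.Ioi 0)) := by
    refine tendsto_nhdsWithin_iff.2 ⟨ht0, ?_⟩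
    filter_upwards [hI] with h hh using (hst h hh).2.2.2.1
  have h2 := (key.comp htt).sqrt
  have h3 := (h2.inv₀ (Real.sqrt_pos.2 (by positivity)).ne')
  rw [one_div]
  refine h3.congr' ?_
  filter_upwards [hI] with h hh
  obtain ⟨-, -, -, ht, -, hft⟩ := hst h hh
  simp only [Function.comp, hft]
  rw [Real.sqrt_div hh.1.le, Real.sqrt_sq ht.le, inv_div]
end

section
/- As h → 0⁺, the quotient (−s(h)·t(h))/h tends to 1/a, where a = f''(0)/2. -/
open Real Filter Set

theorem stmt_5 (p q : ℝ) (hp : p < 0) (hq : 0 < q)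
    (f : ℝ → ℝ) (hf : ContDiffOn ℝ 3 f (Set.Ioo p q))
    (hf0 : f 0 = 0) (hf'0 : deriv f 0 = 0)
    (hconv : ∀ x ∈ Set.Ioo p q, 0 < deriv (deriv f) x)
    (ε : ℝ) (hε : 0 < ε) (s t : ℝ → ℝ)
    (hst : ∀ h ∈ Set.Ioo (0:ℝ) ε, s h ∈ Set.Ioo p q ∧ t h ∈ Set.Ioo p q ∧
      s h < 0 ∧ 0 < t h ∧ f (s h) = h ∧ f (t h) = h)
    (hs0 : Filter.Tendsto s (nhdsWithin 0 (Set.Ioi 0)) (nhds 0))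
    (ht0 : Filter.Tendsto t (nhdsWithin 0 (Set.Ioi 0)) (nhds 0)) :
    Filter.Tendsto (fun h => (-(s h) * t h) / h) (nhdsWithin 0 (Set.Ioi 0))
      (nhds (1 / (deriv (deriv f) 0 / 2))) := by
  have h0 : (0:ℝ) ∈ Set.Ioo p q := ⟨hp, hq⟩
  have hnhds : Set.Ioo p q ∈ nhds (0:ℝ) := Ioo_mem_nhds hp hq
  have hfd : ∀ x ∈ Set.Ioo p q, HasDerivAt f (deriv f x) x := fun x hx =>
    ((hf.differentiableOn (by norm_num)).differentiableAt (isOpen_Ioo.mem_nhds hx)).hasDerivAt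
  have hpos := hconv 0 h0
  have hdd : HasDerivAt (deriv f) (deriv (deriv f) 0) 0 :=
    (differentiableAt_of_deriv_ne_zero hpos.ne').hasDerivAt
  set A := deriv (deriv f) 0 with hA
  have hquot : Tendsto (fun x => f x / x ^ 2) (nhdsWithin 0 {0}ᶜ) (nhds (A / 2)) := by
    refine HasDerivAt.lhopital_zero_nhdsNE (f' := deriv f) (g' := fun x => 2 * x) ?_ ?_ ?_ ?_ ?_ ?_
    · exact nhdsWithin_le_nhds (Filter.mem_of_superset hnhds hfd)
    · exact Filter.Eventually.of_forall fun x => by simpa using hasDerivAt_pow 2 x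
    · filter_upwards [self_mem_nhdsWithin] with x hx
      have : x ≠ 0 := hx
      positivity
    · have := (hfd 0 h0).continuousAt.tendsto
      rw [hf0] at this
      exact this.mono_left nhdsWithin_le_nhds
    · have : Tendsto (fun x : ℝ => x ^ 2) (nhds 0) (nhds 0) := by
        have := (continuous_pow 2 (M := ℝ)).tendsto 0
        simpa using this
      exact this.mono_left nhdsWithin_le_nhds
    · have := (hasDerivAt_iff_tendsto_slope.1 hdd).div_const 2
      refine this.congr fun x => ?_
      rw [slope_def_field, hf'0, sub_zero, sub_zero, div_div, mul_comm]
  have hinv : Tendsto (fun x => x ^ 2 / f x) (nhdsWithin 0 {0}ᶜ) (nhds (1 / (A / 2))) := by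
    have := hquot.inv₀ (by positivity)
    rw [one_div]
    exact this.congr fun x => inv_div _ _
  have hev : ∀ᶠ h in nhdsWithin (0:ℝ) (Set.Ioi 0), h ∈ Set.Ioo (0:ℝ) ε :=
    Ioo_mem_nhdsGT hε
  have hs : Tendsto s (nhdsWithin 0 (Set.Ioi 0)) (nhdsWithin 0 {0}ᶜ) :=
    tendsto_nhdsWithin_iff.2 ⟨hs0, hev.mono fun h hh => (hst h hh).2.2.1.ne⟩
  have ht : Tendsto t (nhdsWithin 0 (Set.Ioi 0)) (nhdsWithin 0 {0}ᶜ) :=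
    tendsto_nhdsWithin_iff.2 ⟨ht0, hev.mono fun h hh => (hst h hh).2.2.2.1.ne'⟩
  have hm := ((hinv.comp hs).mul (hinv.comp ht)).sqrt
  rw [Real.sqrt_mul_self (by positivity)] at hm
  refine hm.congr' ?_
  filter_upwards [hev] with h hh
  obtain ⟨_, _, h1, h2, h3, h4⟩ := hst h hh
  have hh0 : 0 < h := hh.1
  simp only [Function.comp, h3, h4]
  have : s h ^ 2 / h * (t h ^ 2 / h) = ((-(s h) * t h) / h) ^ 2 := by
    field_simp
  rw [this]
  exact Real.sqrt_sq (div_nonneg (mul_nonneg (by linarith) h2.le) hh0.le)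
end

section
/- As h → 0⁺, the quantity η_P(h) := (−s(h)·t(h))/(√h·(t(h) − s(h))) tends to 1/(2√a), where a = f''(0)/2. -/
open Real Filter Set

theorem stmt_6 (p q : ℝ) (hp : p < 0) (hq : 0 < q)
    (f : ℝ → ℝ) (hf : ContDiffOn ℝ 3 f (Set.Ioo p q))
    (hf0 : f 0 = 0) (hf'0 : deriv f 0 = 0)
    (hconv : ∀ x ∈ Set.Ioo p q, 0 < deriv (deriv f) x)
    (ε : ℝ) (hε : 0 < ε) (s t : ℝ → ℝ)
    (hst : ∀ h ∈ Set.Ioo (0:ℝ) ε, s h ∈ Set.Ioo p q ∧ t h ∈ Set.Ioo p q ∧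
      s h < 0 ∧ 0 < t h ∧ f (s h) = h ∧ f (t h) = h)
    (hs0 : Filter.Tendsto s (nhdsWithin 0 (Set.Ioi 0)) (nhds 0))
    (ht0 : Filter.Tendsto t (nhdsWithin 0 (Set.Ioi 0)) (nhds 0)) :
    Filter.Tendsto (fun h => (-(s h) * t h) / (Real.sqrt h * (t h - s h))) (nhdsWithin 0 (Set.Ioi 0))
      (nhds (1 / (2 * Real.sqrt (deriv (deriv f) 0 / 2)))) := by
  have h0 : (0:ℝ) ∈ Set.Ioo p q := ⟨hp, hq⟩
  have hev : ∀ᶠ x in nhds (0:ℝ), x ∈ Set.Ioo p q := isOpen_Ioo.mem_nhds h0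
  have hdiff : ∀ x ∈ Set.Ioo p q, DifferentiableAt ℝ f x := fun x hx =>
    (hf.differentiableOn (by norm_num)).differentiableAt (isOpen_Ioo.mem_nhds hx)
  have ha := hconv 0 h0
  have hd2 : HasDerivAt (deriv f) (deriv (deriv f) 0) 0 :=
    (differentiableAt_of_deriv_ne_zero ha.ne').hasDerivAt
  have hslope := hasDerivAt_iff_tendsto_slope.1 hd2
  have hlim : Tendsto (fun x => f x / x ^ 2) (nhdsWithin 0 {0}ᶜ)
      (nhds (deriv (deriv f) 0 / 2)) := by
    refine HasDerivAt.lhopital_zero_nhdsNE (f' := deriv f) (g' := fun x => 2 * x) ?_ ?_ ?_ ?_ ?_ ?_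
    · filter_upwards [hev.filter_mono nhdsWithin_le_nhds] with x hx
      exact (hdiff x hx).hasDerivAt
    · filter_upwards with x
      simpa using hasDerivAt_pow 2 x
    · filter_upwards [self_mem_nhdsWithin] with x hx
      have : x ≠ 0 := hx
      positivity
    · have := (hdiff 0 h0).continuousAt.tendsto
      rw [hf0] at this
      exact this.mono_left nhdsWithin_le_nhds
    · have : Tendsto (fun x : ℝ => x ^ 2) (nhds 0) (nhds ((0:ℝ) ^ 2)) :=
        (continuous_pow 2).tendsto 0
      rw [show (0:ℝ) ^ 2 = 0 by norm_num] at this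
      exact this.mono_left nhdsWithin_le_nhds
    · refine (hslope.div_const 2).congr fun x => ?_
      rw [slope_def_field, hf'0, sub_zero, sub_zero, div_div, mul_comm]
  have hsq := (Real.continuous_sqrt.tendsto _).comp hlim
  have hevh : ∀ᶠ h in nhdsWithin (0:ℝ) (Set.Ioi 0), h ∈ Set.Ioo (0:ℝ) ε := Ioo_mem_nhdsGT hε
  have hS : Tendsto (fun h => Real.sqrt h / (-(s h))) (nhdsWithin 0 (Set.Ioi 0))
      (nhds (Real.sqrt (deriv (deriv f) 0 / 2))) := by
    have h1 : Tendsto s (nhdsWithin 0 (Set.Ioi 0)) (nhdsWithin 0 {0}ᶜ) :=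
      tendsto_nhdsWithin_iff.2 ⟨hs0, hevh.mono fun h hh => (hst h hh).2.2.1.ne⟩
    refine (hsq.comp h1).congr' (hevh.mono fun h hh => ?_)
    obtain ⟨-, -, hs, -, hfs, -⟩ := hst h hh
    simp only [Function.comp]
    rw [hfs, Real.sqrt_div hh.1.le, Real.sqrt_sq_eq_abs, abs_of_neg hs]
  have hT : Tendsto (fun h => Real.sqrt h / t h) (nhdsWithin 0 (Set.Ioi 0))
      (nhds (Real.sqrt (deriv (deriv f) 0 / 2))) := by
    have h1 : Tendsto t (nhdsWithin 0 (Set.Ioi 0)) (nhdsWithin 0 {0}ᶜ) :=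
      tendsto_nhdsWithin_iff.2 ⟨ht0, hevh.mono fun h hh => (hst h hh).2.2.2.1.ne'⟩
    refine (hsq.comp h1).congr' (hevh.mono fun h hh => ?_)
    obtain ⟨-, -, -, ht, -, hft⟩ := hst h hh
    simp only [Function.comp]
    rw [hft, Real.sqrt_div hh.1.le, Real.sqrt_sq_eq_abs, abs_of_pos ht]
  have hpos : 0 < Real.sqrt (deriv (deriv f) 0 / 2) := Real.sqrt_pos.2 (by linarith)
  have hfin := (hS.add hT).inv₀ (by positivity)
  rw [← two_mul, ← one_div] at hfin
  refine hfin.congr' (hevh.mono fun h hh => ?_)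
  obtain ⟨-, -, hs, ht, -, -⟩ := hst h hh
  have hr : Real.sqrt h ≠ 0 := (Real.sqrt_pos.2 hh.1).ne'
  have hs' : -(s h) ≠ 0 := neg_ne_zero.2 hs.ne
  rw [div_add_div _ _ hs' ht.ne', inv_div]
  congr 1
  ring
end

section
/- As h → 0⁺, the quantity γ_P(h) := (−f'(s(h)) f'(t(h)))/(√h·(t(h) − s(h))) tends to 2a√a, where a = f''(0)/2. -/
open Real Filter Set

theorem stmt_8 (p q : ℝ) (hp : p < 0) (hq : 0 < q)
    (f : ℝ → ℝ) (hf : ContDiffOn ℝ 3 f (Set.Ioo p q))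
    (hf0 : f 0 = 0) (hf'0 : deriv f 0 = 0)
    (hconv : ∀ x ∈ Set.Ioo p q, 0 < deriv (deriv f) x)
    (ε : ℝ) (hε : 0 < ε) (s t : ℝ → ℝ)
    (hst : ∀ h ∈ Set.Ioo (0:ℝ) ε, s h ∈ Set.Ioo p q ∧ t h ∈ Set.Ioo p q ∧
      s h < 0 ∧ 0 < t h ∧ f (s h) = h ∧ f (t h) = h)
    (hs0 : Filter.Tendsto s (nhdsWithin 0 (Set.Ioi 0)) (nhds 0))
    (ht0 : Filter.Tendsto t (nhdsWithin 0 (Set.Ioi 0)) (nhds 0)) :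
    Filter.Tendsto (fun h => (-(deriv f (s h) * deriv f (t h))) / (Real.sqrt h * (t h - s h)))
      (nhdsWithin 0 (Set.Ioi 0))
      (nhds (2 * (deriv (deriv f) 0 / 2) * Real.sqrt (deriv (deriv f) 0 / 2))) := by 
  have h0mem : (0:ℝ) ∈ Set.Ioo p q := ⟨hp, hq⟩
  set c := deriv (deriv f) 0 with hc
  have hcpos : 0 < c := hconv 0 h0mem
  have hd2 : HasDerivAt (deriv f) c 0 :=
    (differentiableAt_of_deriv_ne_zero (ne_of_gt hcpos)).hasDerivAt
  have hnb : Set.Ioo p q ∈ nhds (0:ℝ) := Ioo_mem_nhds hp hq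
  have hdiff : ∀ x ∈ Set.Ioo p q, DifferentiableAt ℝ f x := fun x hx =>
    (hf.contDiffAt (Ioo_mem_nhds hx.1 hx.2)).differentiableAt (by norm_num)
  -- first order quotient
  have hA : Filter.Tendsto (fun x => deriv f x / x) (nhdsWithin 0 {0}ᶜ) (nhds c) := by
    have h := hasDerivAt_iff_tendsto_slope.1 hd2
    refine h.congr (fun x => ?_)
    rw [slope_def_field, hf'0, sub_zero, sub_zero]
  -- second order quotient
  have hB : Filter.Tendsto (fun x => f x / x ^ 2) (nhdsWithin 0 {0}ᶜ) (nhds (c / 2)) := by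
    apply HasDerivAt.lhopital_zero_nhdsNE (f' := deriv f) (g' := fun x => 2 * x)
    · filter_upwards [mem_nhdsWithin_of_mem_nhds hnb] with x hx
      exact (hdiff x hx).hasDerivAt
    · refine Filter.Eventually.of_forall (fun x => ?_)
      simpa using hasDerivAt_pow 2 x
    · filter_upwards [self_mem_nhdsWithin] with x hx
      exact mul_ne_zero two_ne_zero hx
    · have := (hdiff 0 h0mem).continuousAt.tendsto
      rw [hf0] at this
      exact this.mono_left nhdsWithin_le_nhds
    · have : Filter.Tendsto (fun x : ℝ => x ^ 2) (nhds 0) (nhds (0 ^ 2)) :=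
        (continuous_pow 2).tendsto 0
      rw [zero_pow two_ne_zero] at this
      exact this.mono_left nhdsWithin_le_nhds
    · refine (hA.div_const 2).congr (fun x => ?_)
      rw [div_div, mul_comm]
  have hev : ∀ᶠ h in nhdsWithin (0:ℝ) (Set.Ioi 0), h ∈ Set.Ioo (0:ℝ) ε :=
    Ioo_mem_nhdsGT hε
  have hs1 : Filter.Tendsto s (nhdsWithin 0 (Set.Ioi 0)) (nhdsWithin 0 {0}ᶜ) :=
    tendsto_nhdsWithin_iff.2 ⟨hs0, hev.mono fun h hh => ne_of_lt (hst h hh).2.2.1⟩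
  have ht1 : Filter.Tendsto t (nhdsWithin 0 (Set.Ioi 0)) (nhdsWithin 0 {0}ᶜ) :=
    tendsto_nhdsWithin_iff.2 ⟨ht0, hev.mono fun h hh => ne_of_gt (hst h hh).2.2.2.1⟩
  have hr : 0 < Real.sqrt (c / 2) := Real.sqrt_pos.2 (by positivity)
  have hsq : Real.sqrt (c / 2) ^ 2 = c / 2 := Real.sq_sqrt (by positivity)
  have hS := ((hB.comp hs1).sqrt).inv₀ hr.ne'
  have hT := ((hB.comp ht1).sqrt).inv₀ hr.ne'
  have hmain := ((((hA.comp hs1).mul (hA.comp ht1)).mul hS).mul hT).div (hS.add hT)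
    (by positivity)
  have hlim : c * c * (Real.sqrt (c / 2))⁻¹ * (Real.sqrt (c / 2))⁻¹ /
      ((Real.sqrt (c / 2))⁻¹ + (Real.sqrt (c / 2))⁻¹)
      = 2 * (c / 2) * Real.sqrt (c / 2) := by
    generalize Real.sqrt (c / 2) = r at *
    have hc2 : c = 2 * r ^ 2 := by linarith
    rw [hc2]
    field_simp
    try ring
  rw [hlim] at hmain
  refine hmain.congr' ?_
  filter_upwards [hev] with h hh
  obtain ⟨-, -, hsn, htp, hfs, hft⟩ := hst h hh
  have hh0 : 0 < Real.sqrt h := Real.sqrt_pos.2 hh.1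
  have e1 : Real.sqrt (f (s h) / s h ^ 2) = Real.sqrt h / (-s h) := by
    rw [hfs, Real.sqrt_div hh.1.le, Real.sqrt_sq_eq_abs, abs_of_neg hsn]
  have e2 : Real.sqrt (f (t h) / t h ^ 2) = Real.sqrt h / t h := by
    rw [hft, Real.sqrt_div hh.1.le, Real.sqrt_sq_eq_abs, abs_of_pos htp]
  simp only [Pi.div_apply, Function.comp, e1, e2, inv_div]
  have hsne := hsn.ne
  have htne := htp.ne'
  have hden : t h - s h ≠ 0 := by linarith
  have e3 : -s h / Real.sqrt h + t h / Real.sqrt h = (t h - s h) / Real.sqrt h := by ring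
  rw [e3]
  field_simp
end

section
/- If there exist a real number λ and δ > 0 such that U_P(h) = λ·T_P(h) for all h ∈ (0, δ), then λ = 1/2. -/
open Real Filter Set

theorem stmt_11 (p q : ℝ) (hp : p < 0) (hq : 0 < q)
    (f : ℝ → ℝ) (hf : ContDiffOn ℝ 3 f (Set.Ioo p q))
    (hf0 : f 0 = 0) (hf'0 : deriv f 0 = 0)
    (hconv : ∀ x ∈ Set.Ioo p q, 0 < deriv (deriv f) x)
    (ε : ℝ) (hε : 0 < ε) (s t : ℝ → ℝ)
    (hst : ∀ h ∈ Set.Ioo (0:ℝ) ε, s h ∈ Set.Ioo p q ∧ t h ∈ Set.Ioo p q ∧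
      s h < 0 ∧ 0 < t h ∧ f (s h) = h ∧ f (t h) = h)
    (hs0 : Filter.Tendsto s (nhdsWithin 0 (Set.Ioi 0)) (nhds 0))
    (ht0 : Filter.Tendsto t (nhdsWithin 0 (Set.Ioi 0)) (nhds 0))
    (lam δ : ℝ) (hδ : 0 < δ)
    (hU : ∀ h ∈ Set.Ioo (0:ℝ) δ, ((1:ℝ)/2) * (h^2 * (deriv f (t h) - deriv f (s h)) / (-(deriv f (s h) * deriv f (t h))) - 2*h*(t h - s h) + (-(deriv f (s h) * deriv f (t h))) * (t h - s h)^2 / (deriv f (t h) - deriv f (s h))) = lam * (h/2 * (t h - s h))) :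
    lam = 1/2 := by
  have h0 : (0:ℝ) ∈ Set.Ioo p q := ⟨hp, hq⟩
  obtain ⟨a, ha⟩ : ∃ a, deriv (deriv f) 0 = 2 * a := ⟨deriv (deriv f) 0 / 2, by ring⟩
  have hapos : 0 < a := by have := hconv 0 h0; linarith
  have hdd : HasDerivAt (deriv f) (2 * a) 0 := by
    rw [← ha]
    exact (differentiableAt_of_deriv_ne_zero (hconv 0 h0).ne').hasDerivAt
  have hdiff : ∀ x ∈ Set.Ioo p q, DifferentiableAt ℝ f x := fun x hx =>
    (hf.differentiableOn (by norm_num)).differentiableAt (isOpen_Ioo.mem_nhds hx)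
  have hA : Tendsto (fun x => deriv f x / x) (nhdsWithin 0 {0}ᶜ) (nhds (2 * a)) := by
    have := hasDerivAt_iff_tendsto_slope.1 hdd
    refine this.congr fun x => ?_
    simp [slope_def_field, hf'0]
  have hH : Tendsto (fun x => f x / x ^ 2) (nhdsWithin 0 {0}ᶜ) (nhds a) := by
    apply deriv.lhopital_zero_nhdsNE
    · exact nhdsWithin_le_nhds (by
        filter_upwards [isOpen_Ioo.mem_nhds h0] with x hx using hdiff x hx)
    · filter_upwards [self_mem_nhdsWithin] with x hx
      simpa using hx
    · have := (hdiff 0 h0).continuousAt.tendsto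
      rw [hf0] at this
      exact this.mono_left nhdsWithin_le_nhds
    · have : Tendsto (fun x : ℝ => x ^ 2) (nhds 0) (nhds (0 ^ 2)) :=
        (continuous_pow 2).tendsto 0
      simp only [ne_eq, OfNat.ofNat_ne_zero, not_false_eq_true, zero_pow] at this
      exact this.mono_left nhdsWithin_le_nhds
    · have := hA.div_const 2
      rw [mul_div_cancel_left₀ a two_ne_zero] at this
      refine this.congr fun x => ?_
      simp [div_div, mul_comm]
  have hev : ∀ᶠ h in nhdsWithin (0:ℝ) (Set.Ioi 0), h ∈ Set.Ioo 0 ε :=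
    Ioo_mem_nhdsGT hε
  have hevδ : ∀ᶠ h in nhdsWithin (0:ℝ) (Set.Ioi 0), h ∈ Set.Ioo 0 δ :=
    Ioo_mem_nhdsGT hδ
  have hs1 : Tendsto s (nhdsWithin 0 (Set.Ioi 0)) (nhdsWithin 0 {0}ᶜ) :=
    tendsto_nhdsWithin_iff.2 ⟨hs0, hev.mono fun h hh => (hst h hh).2.2.1.ne⟩
  have ht1 : Tendsto t (nhdsWithin 0 (Set.Ioi 0)) (nhdsWithin 0 {0}ᶜ) :=
    tendsto_nhdsWithin_iff.2 ⟨ht0, hev.mono fun h hh => (hst h hh).2.2.2.1.ne'⟩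
  have lHt : Tendsto (fun h => h / t h ^ 2) (nhdsWithin 0 (Set.Ioi 0)) (nhds a) :=
    (hH.comp ht1).congr' (hev.mono fun h hh => by simp [(hst h hh).2.2.2.2.2])
  have lHs : Tendsto (fun h => h / s h ^ 2) (nhdsWithin 0 (Set.Ioi 0)) (nhds a) :=
    (hH.comp hs1).congr' (hev.mono fun h hh => by simp [(hst h hh).2.2.2.2.1])
  have lu : Tendsto (fun h => s h / t h) (nhdsWithin 0 (Set.Ioi 0)) (nhds (-1)) := by
    have h1 := ((lHt.div lHs hapos.ne').sqrt).neg
    rw [div_self hapos.ne', Real.sqrt_one] at h1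
    refine h1.congr' (hev.mono fun h hh => ?_)
    obtain ⟨-, -, h3, h4, -, -⟩ := hst h hh
    have hh0 : h ≠ 0 := hh.1.ne'
    have : h / t h ^ 2 / (h / s h ^ 2) = (-(s h / t h)) ^ 2 := by
      field_simp
    simp only [Pi.div_apply]
    rw [this, Real.sqrt_sq, neg_neg]
    have := div_neg_of_neg_of_pos h3 h4
    linarith
  have lA : Tendsto (fun h => deriv f (t h) / t h) (nhdsWithin 0 (Set.Ioi 0)) (nhds (2 * a)) :=
    hA.comp ht1
  have lB : Tendsto (fun h => deriv f (s h) / t h) (nhdsWithin 0 (Set.Ioi 0))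
      (nhds (2 * a * (-1))) := by
    refine ((hA.comp hs1).mul lu).congr' (hev.mono fun h hh => ?_)
    obtain ⟨-, -, h3, h4, -, -⟩ := hst h hh
    have := h3.ne
    simp only [Function.comp]
    field_simp
  have hAB : 2 * a - 2 * a * (-1) ≠ 0 := by nlinarith
  have hBA : -(2 * a * (-1) * (2 * a)) ≠ 0 := by nlinarith
  have lL := ((((lHt.pow 2).mul (lA.sub lB)).div (lB.mul lA).neg hBA).sub
    ((lHt.const_mul 2).mul (lu.const_sub 1))).add
    (((lB.mul lA).neg.mul ((lu.const_sub 1).pow 2)).div (lA.sub lB) hAB)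
  have lL := lL.const_mul ((1:ℝ)/2)
  have lR := ((lHt.div_const 2).mul (lu.const_sub 1)).const_mul lam
  have key := tendsto_nhds_unique (lL.congr' ?_) lR
  · field_simp at key
    nlinarith
  · filter_upwards [hev, hevδ, (lA.sub lB).eventually_ne hAB,
      (lB.mul lA).neg.eventually_ne hBA] with h hh hd hne1 hne2
    obtain ⟨-, -, h3, h4, -, -⟩ := hst h hh
    have hu := hU h hd
    have e1 : deriv f (t h) = deriv f (t h) / t h * t h := by field_simp
    have e2 : deriv f (s h) = deriv f (s h) / t h * t h := by field_simp
    have e3 : h = h / t h ^ 2 * t h ^ 2 := by field_simp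
    have e4 : s h = s h / t h * t h := by field_simp
    simp only [Pi.div_apply] at *
    generalize deriv f (t h) / t h = A at *
    generalize deriv f (s h) / t h = B at *
    generalize h / t h ^ 2 = H at *
    generalize s h / t h = u at *
    generalize deriv f (t h) = A' at *
    generalize deriv f (s h) = B' at *
    generalize s h = s' at *
    generalize t h = T at *
    subst e1 e2 e4
    clear hst hU
    rw [e3] at hu
    have hT3 : T ^ 3 ≠ 0 := by positivity
    apply mul_left_cancel₀ hT3
    have hT : T ≠ 0 := h4.ne'
    have r1 : (H * T ^ 2) ^ 2 * (A * T - B * T) / (-(B * T * (A * T)))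
        = T ^ 3 * (H ^ 2 * (A - B) / (-(B * A))) := by
      have : -(B * T * (A * T)) = T ^ 2 * (-(B * A)) := by ring
      rw [this]
      generalize -(B * A) = D at *
      field_simp
    have r2 : (-(B * T * (A * T))) * (T - u * T) ^ 2 / (A * T - B * T)
        = T ^ 3 * ((-(B * A)) * (1 - u) ^ 2 / (A - B)) := by
      have : A * T - B * T = T * (A - B) := by ring
      rw [this]
      generalize A - B = D at *
      field_simp
    rw [r1, r2] at hu
    linear_combination hu
end

section
/- If there exist real numbers λ, μ and δ > 0 such that U_P(h) = λ·(T_P(h))^μ for all h ∈ (0, δ), then μ = 1 and λ = 1/2. -/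
open Real Filter Set

lemma aux_f' (f : ℝ → ℝ) (hf'0 : deriv f 0 = 0) (h2 : 0 < deriv (deriv f) 0) :
    Tendsto (fun x => deriv f x / x) (nhdsWithin 0 {0}ᶜ) (nhds (deriv (deriv f) 0)) := by
  have hd : DifferentiableAt ℝ (deriv f) 0 := differentiableAt_of_deriv_ne_zero h2.ne'
  have := hd.hasDerivAt.tendsto_slope
  refine this.congr (fun x => ?_)
  simp [slope_def_field, hf'0]

lemma aux_f (f : ℝ → ℝ) (hf0 : f 0 = 0) (hf'0 : deriv f 0 = 0) (h2 : 0 < deriv (deriv f) 0)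
    (hd : ∀ᶠ x in nhds (0:ℝ), DifferentiableAt ℝ f x) :
    Tendsto (fun x => f x / x ^ 2) (nhdsWithin 0 {0}ᶜ) (nhds (deriv (deriv f) 0 / 2)) := by
  have h0 : ContinuousAt f 0 := hd.self_of_nhds.continuousAt
  have hw : ∀ᶠ x in nhdsWithin (0:ℝ) {0}ᶜ, DifferentiableAt ℝ f x :=
    hd.filter_mono nhdsWithin_le_nhds
  refine HasDerivAt.lhopital_zero_nhdsNE (f' := deriv f) (g' := fun x => 2 * x) ?_ ?_ ?_ ?_ ?_ ?_
  · filter_upwards [hw] with x hx using hx.hasDerivAt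
  · refine Eventually.of_forall (fun x => ?_)
    simpa using hasDerivAt_pow 2 x
  · filter_upwards [self_mem_nhdsWithin] with x hx
    exact mul_ne_zero two_ne_zero hx
  · have := h0.tendsto
    rw [hf0] at this
    exact this.mono_left nhdsWithin_le_nhds
  · have : Tendsto (fun x : ℝ => x ^ 2) (nhds 0) (nhds (0 ^ 2)) := (continuous_pow 2).tendsto 0
    simp only [ne_eq, OfNat.ofNat_ne_zero, not_false_eq_true, zero_pow] at this
    exact this.mono_left nhdsWithin_le_nhds
  · refine ((aux_f' f hf'0 h2).div_const 2).congr (fun x => ?_)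
    rw [div_div, mul_comm]

lemma aux_pow (T : ℝ → ℝ) (l : Filter ℝ) [l.NeBot] (lam μ : ℝ)
    (hT : Tendsto T l (nhdsWithin 0 (Ioi 0)))
    (h : Tendsto (fun x => lam * (T x) ^ (μ - 1)) l (nhds (1 / 2))) : μ = 1 ∧ lam = 1 / 2 := by
  have hT0 : Tendsto T l (nhds 0) := hT.mono_right nhdsWithin_le_nhds
  rcases lt_trichotomy μ 1 with hm | hm | hm
  · exfalso
    have h1 : Tendsto (fun x => (T x) ^ (1 - μ)) l (nhds 0) := by
      have := hT0.rpow_const (p := 1 - μ) (Or.inr (by linarith))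
      rwa [Real.zero_rpow (by linarith)] at this
    have h3 := h.mul h1
    have h4 : Tendsto (fun _ : ℝ => lam) l (nhds (1 / 2 * 0)) := by
      refine h3.congr' ?_
      filter_upwards [hT.eventually self_mem_nhdsWithin] with x hx
      have hx : 0 < T x := hx
      rw [mul_assoc, ← Real.rpow_add hx]
      simp
    have h5 : lam = 1 / 2 * 0 := tendsto_nhds_unique tendsto_const_nhds h4
    simp only [mul_zero] at h5
    subst h5
    simp only [zero_mul] at h
    have := tendsto_nhds_unique tendsto_const_nhds h
    norm_num at this
  · subst hm
    refine ⟨rfl, ?_⟩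
    simp only [sub_self, Real.rpow_zero, mul_one] at h
    exact tendsto_nhds_unique tendsto_const_nhds h
  · exfalso
    have h1 : Tendsto (fun x => (T x) ^ (μ - 1)) l (nhds 0) := by
      have := hT0.rpow_const (p := μ - 1) (Or.inr (by linarith))
      rwa [Real.zero_rpow (by linarith)] at this
    have := tendsto_nhds_unique (h1.const_mul lam) h
    norm_num at this

theorem stmt_12 (p q : ℝ) (hp : p < 0) (hq : 0 < q)
    (f : ℝ → ℝ) (hf : ContDiffOn ℝ 3 f (Set.Ioo p q))
    (hf0 : f 0 = 0) (hf'0 : deriv f 0 = 0)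
    (hconv : ∀ x ∈ Set.Ioo p q, 0 < deriv (deriv f) x)
    (ε : ℝ) (hε : 0 < ε) (s t : ℝ → ℝ)
    (hst : ∀ h ∈ Set.Ioo (0:ℝ) ε, s h ∈ Set.Ioo p q ∧ t h ∈ Set.Ioo p q ∧
      s h < 0 ∧ 0 < t h ∧ f (s h) = h ∧ f (t h) = h)
    (hs0 : Filter.Tendsto s (nhdsWithin 0 (Set.Ioi 0)) (nhds 0))
    (ht0 : Filter.Tendsto t (nhdsWithin 0 (Set.Ioi 0)) (nhds 0))
    (lam μ δ : ℝ) (hδ : 0 < δ)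
    (hU : ∀ h ∈ Set.Ioo (0:ℝ) δ, ((1:ℝ)/2) * (h^2 * (deriv f (t h) - deriv f (s h)) / (-(deriv f (s h) * deriv f (t h))) - 2*h*(t h - s h) + (-(deriv f (s h) * deriv f (t h))) * (t h - s h)^2 / (deriv f (t h) - deriv f (s h))) = lam * (h/2 * (t h - s h)) ^ μ) :
    μ = 1 ∧ lam = 1/2 := by
  have h0I : (0:ℝ) ∈ Set.Ioo p q := ⟨hp, hq⟩
  have hb := hconv 0 h0I
  have hd : ∀ᶠ x in nhds (0:ℝ), DifferentiableAt ℝ f x := by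
    filter_upwards [isOpen_Ioo.mem_nhds h0I] with x hx
    exact (hf.differentiableOn (by norm_num)).differentiableAt (isOpen_Ioo.mem_nhds hx)
  have A := aux_f f hf0 hf'0 hb hd
  have B := aux_f' f hf'0 hb
  obtain ⟨c, hc⟩ : ∃ c, c = deriv (deriv f) 0 / 2 := ⟨_, rfl⟩
  have hc0 : 0 < c := by rw [hc]; linarith
  rw [← hc] at A
  have hb2 : deriv (deriv f) 0 = 2 * c := by rw [hc]; ring
  rw [hb2] at B
  have hev : ∀ᶠ h in nhdsWithin (0:ℝ) (Set.Ioi 0), h ∈ Set.Ioo (0:ℝ) ε :=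
    Ioo_mem_nhdsGT hε
  have hev2 : ∀ᶠ h in nhdsWithin (0:ℝ) (Set.Ioi 0), h ∈ Set.Ioo (0:ℝ) δ :=
    Ioo_mem_nhdsGT hδ
  have hs1 : Tendsto s (nhdsWithin 0 (Set.Ioi 0)) (nhdsWithin 0 {0}ᶜ) := by
    refine tendsto_nhdsWithin_iff.2 ⟨hs0, ?_⟩
    filter_upwards [hev] with h hh using (hst h hh).2.2.1.ne
  have ht1 : Tendsto t (nhdsWithin 0 (Set.Ioi 0)) (nhdsWithin 0 {0}ᶜ) := by
    refine tendsto_nhdsWithin_iff.2 ⟨ht0, ?_⟩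
    filter_upwards [hev] with h hh using (hst h hh).2.2.2.1.ne'
  obtain ⟨k, hk⟩ : ∃ k, k = √(c⁻¹) := ⟨_, rfl⟩
  have hk0 : 0 < k := by rw [hk]; positivity
  have hck : c * k ^ 2 = 1 := by
    rw [hk, Real.sq_sqrt (by positivity)]; field_simp
  have tl : Tendsto (fun h => t h / √h) (nhdsWithin 0 (Set.Ioi 0)) (nhds k) := by
    rw [hk]
    refine ((A.comp ht1).inv₀ hc0.ne').sqrt.congr' ?_
    filter_upwards [hev] with h hh
    obtain ⟨_, _, _, h4, _, h6⟩ := hst h hh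
    simp only [Function.comp, h6, inv_div]
    rw [Real.sqrt_div' _ hh.1.le, Real.sqrt_sq h4.le]
  have sl : Tendsto (fun h => s h / √h) (nhdsWithin 0 (Set.Ioi 0)) (nhds (-k)) := by
    rw [hk]
    refine ((A.comp hs1).inv₀ hc0.ne').sqrt.neg.congr' ?_
    filter_upwards [hev] with h hh
    obtain ⟨_, _, h4, _, h6, _⟩ := hst h hh
    simp only [Function.comp, h6, inv_div]
    rw [Real.sqrt_div' _ hh.1.le, Real.sqrt_sq_eq_abs, abs_of_neg h4]
    ring
  have Fl : Tendsto (fun h => deriv f (t h) / √h) (nhdsWithin 0 (Set.Ioi 0))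
      (nhds (2 * c * k)) := by
    refine ((B.comp ht1).mul tl).congr' ?_
    filter_upwards [hev] with h hh
    have := (hst h hh).2.2.2.1.ne'
    simp only [Function.comp]
    field_simp
  have Gl : Tendsto (fun h => deriv f (s h) / √h) (nhdsWithin 0 (Set.Ioi 0))
      (nhds (2 * c * (-k))) := by
    refine ((B.comp hs1).mul sl).congr' ?_
    filter_upwards [hev] with h hh
    have := (hst h hh).2.2.1.ne
    simp only [Function.comp]
    field_simp
  have hck' : 0 < c * k := by positivity
  have Dl := tl.sub sl
  have El := Fl.sub Gl
  have Pl := (Gl.mul Fl).neg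
  have hP : -(2 * c * (-k) * (2 * c * k)) ≠ 0 := by
    have : 0 < -(2 * c * (-k) * (2 * c * k)) := by
      have : -(2 * c * (-k) * (2 * c * k)) = 4 * (c * k) ^ 2 := by ring
      rw [this]; positivity
    exact this.ne'
  have hE : 2 * c * k - 2 * c * (-k) ≠ 0 := by
    have : 2 * c * k - 2 * c * (-k) = 4 * (c * k) := by ring
    rw [this]; positivity
  have hD : (k - -k) / 2 ≠ 0 := by
    have : (k - -k) / 2 = k := by ring
    rw [this]; positivity
  have Q := ((((El.div Pl hP).sub (Dl.const_mul 2)).add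
    ((Pl.mul (Dl.pow 2)).div El hE)).const_mul (1/2)).div (Dl.div_const 2) hD
  have hval : 1 / 2 * ((2 * c * k - 2 * c * -k) / -(2 * c * -k * (2 * c * k)) - 2 * (k - -k) +
      -(2 * c * -k * (2 * c * k)) * (k - -k) ^ 2 / (2 * c * k - 2 * c * -k)) / ((k - -k) / 2)
      = 1 / 2 := by
    have hc' : c = 1 / k ^ 2 := by field_simp; linarith
    rw [hc']
    field_simp
    ring
  rw [hval] at Q
  have hTp : ∀ h ∈ Set.Ioo (0:ℝ) ε, 0 < h / 2 * (t h - s h) := by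
    intro h hh
    obtain ⟨_, _, h3, h4, _, _⟩ := hst h hh
    have := hh.1
    have : 0 < t h - s h := by linarith
    positivity
  refine aux_pow (fun h => h / 2 * (t h - s h)) (nhdsWithin 0 (Set.Ioi 0)) lam μ ?_ ?_
  · refine tendsto_nhdsWithin_iff.2 ⟨?_, ?_⟩
    · have hid : Tendsto (fun h : ℝ => h) (nhdsWithin 0 (Set.Ioi 0)) (nhds 0) :=
        tendsto_id.mono_left nhdsWithin_le_nhds
      have := (hid.div_const 2).mul (ht0.sub hs0)
      simpa using this
    · filter_upwards [hev] with h hh using hTp h hh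
  · refine Q.congr' ?_
    filter_upwards [hev, hev2] with h hh hh2
    have hT := hTp h hh
    rw [Real.rpow_sub hT, Real.rpow_one, ← mul_div_assoc, ← hU h hh2]
    have hr : 0 < √h := Real.sqrt_pos.2 hh.1
    have hrr : h = √h ^ 2 := (Real.sq_sqrt hh.1.le).symm
    simp only [Pi.div_apply, Pi.mul_apply, Pi.sub_apply, Pi.add_apply, Pi.neg_apply, Pi.pow_apply]
    generalize deriv f (t h) = F at *
    generalize deriv f (s h) = G at *
    generalize t h = x at *
    generalize s h = y at *
    generalize √h = r at *
    subst hrr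
    have e1 : (F / r - G / r) / -(G / r * (F / r)) = r * ((F - G) / -(G * F)) := by
      rw [← sub_div, div_mul_div_comm, ← neg_div, div_div_div_eq]
      rw [show (F - G) * (r * r) = r * (r * (F - G)) by ring, mul_div_mul_left _ _ hr.ne']
      ring
    have e2 : -(G / r * (F / r)) * (x / r - y / r) ^ 2 / (F / r - G / r)
        = (-(G * F) * (x - y) ^ 2 / (F - G)) / r ^ 3 := by
      rw [← sub_div, ← sub_div, div_div_eq_mul_div]
      field_simp
    rw [e1, e2]
    have hxy : x - y ≠ 0 := by
      intro h0
      rw [h0] at hT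
      simp at hT
    rw [mul_div_assoc ((r ^ 2) ^ 2) (F - G)]
    generalize (F - G) / -(G * F) = M
    generalize -(G * F) * (x - y) ^ 2 / (F - G) = N
    rw [← sub_div]
    field_simp
end

section
/- Suppose that U(s,t) = T(s,t)/2 for all s, t ∈ I with 0 < s < t or t < s < 0. Then f(t)·f'(t)² = 4a·(t f'(t) − f(t))² for every t ∈ I, where a = f''(0)/2. -/
open Real Filter Set

theorem stmt_13 (p q : ℝ) (hp : p < 0) (hq : 0 < q)
    (f : ℝ → ℝ) (hf : ContDiffOn ℝ 3 f (Set.Ioo p q))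
    (hf0 : f 0 = 0) (hf'0 : deriv f 0 = 0)
    (hconv : ∀ x ∈ Set.Ioo p q, 0 < deriv (deriv f) x)
    (hUT : ∀ s ∈ Set.Ioo p q, ∀ t ∈ Set.Ioo p q, ((0 < s ∧ s < t) ∨ (t < s ∧ s < 0)) →
      (1/2) * |((t - s) * deriv f t * deriv f s + f s * deriv f t - deriv f s * f t)^2 /
          (deriv f s * deriv f t * (deriv f t - deriv f s))| =
        (|s * f t - t * f s| / 2) / 2) :
    ∀ t ∈ Set.Ioo p q,
      f t * (deriv f t)^2 = 4 * (deriv (deriv f) 0 / 2) * (t * deriv f t - f t)^2 := by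
  have h0 : (0:ℝ) ∈ Set.Ioo p q := ⟨hp, hq⟩
  have hd : ∀ x ∈ Set.Ioo p q, DifferentiableAt ℝ f x := fun x hx =>
    (hf.differentiableOn (by norm_num)).differentiableAt (isOpen_Ioo.mem_nhds hx)
  have hd2 : ∀ x ∈ Set.Ioo p q, DifferentiableAt ℝ (deriv f) x := fun x hx =>
    differentiableAt_of_deriv_ne_zero (hconv x hx).ne'
  have hmono : StrictMonoOn (deriv f) (Set.Ioo p q) := by
    apply strictMonoOn_of_deriv_pos (convex_Ioo p q)
    · exact fun x hx => (hd2 x hx).continuousAt.continuousWithinAt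
    · intro x hx
      rw [interior_Ioo] at hx
      exact hconv x hx
  have hL1 : Tendsto (fun s => f s / s) (nhdsWithin 0 {0}ᶜ) (nhds 0) := by
    have := (hd 0 h0).hasDerivAt.tendsto_slope
    rw [hf'0] at this
    refine this.congr fun s => ?_
    simp [slope_def_field, hf0]
  have hL2 : Tendsto (fun s => deriv f s / s) (nhdsWithin 0 {0}ᶜ)
      (nhds (deriv (deriv f) 0)) := by
    have := (hd2 0 h0).hasDerivAt.tendsto_slope
    refine this.congr fun s => ?_
    simp [slope_def_field, hf'0]
  have hL3 : Tendsto (fun s => deriv f s) (nhdsWithin 0 {0}ᶜ) (nhds 0) := by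
    have := (hd2 0 h0).continuousAt.tendsto
    rw [hf'0] at this
    exact this.mono_left nhdsWithin_le_nhds
  have hL4 : Tendsto (fun s : ℝ => s) (nhdsWithin 0 {0}ᶜ) (nhds 0) :=
    tendsto_id.mono_left nhdsWithin_le_nhds
  have key : ∀ t ∈ Set.Ioo p q, t ≠ 0 → 0 ≤ f t → ∀ l : Filter ℝ, l.NeBot →
      l ≤ nhdsWithin 0 {0}ᶜ →
      (∀ᶠ s in l, (0 < s ∧ s < t) ∨ (t < s ∧ s < 0)) →
      f t * (deriv f t)^2 = 4 * (deriv (deriv f) 0 / 2) * (t * deriv f t - f t)^2 := by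
    intro t ht ht0 hft l hl hle hev
    have hc := hconv 0 h0
    set c := deriv (deriv f) 0 with hcdef
    have l1 := hL1.mono_left hle
    have l2 := hL2.mono_left hle
    have l3 := hL3.mono_left hle
    have l4 := hL4.mono_left hle
    have A : Tendsto (fun s => 2 * ((t - s) * deriv f t * (deriv f s / s) + (f s / s) * deriv f t
        - (deriv f s / s) * f t)^2) l
        (nhds (2 * ((t - 0) * deriv f t * c + 0 * deriv f t - c * f t)^2)) :=
      ((((((tendsto_const_nhds.sub l4).mul_const _).mul l2).add (l1.mul_const _)).sub
        (l2.mul_const _)).pow 2).const_mul 2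
    have B : Tendsto (fun s => |(deriv f s / s) * deriv f t * (deriv f t - deriv f s)| *
        |f t - t * (f s / s)|) l
        (nhds (|c * deriv f t * (deriv f t - 0)| * |f t - t * 0|)) :=
      ((l2.mul_const _).mul (tendsto_const_nhds.sub l3)).abs.mul
        (tendsto_const_nhds.sub (l1.const_mul t)).abs
    have E : (fun s => 2 * ((t - s) * deriv f t * (deriv f s / s) + (f s / s) * deriv f t
        - (deriv f s / s) * f t)^2) =ᶠ[l] (fun s => |(deriv f s / s) * deriv f t *
          (deriv f t - deriv f s)| * |f t - t * (f s / s)|) := by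
      filter_upwards [hev] with s hs
      have hsI : s ∈ Set.Ioo p q := by
        rcases hs with hs | hs
        · exact ⟨hp.trans hs.1, hs.2.trans ht.2⟩
        · exact ⟨ht.1.trans hs.1, hs.2.trans hq⟩
      have hs0 : s ≠ 0 := by
        rcases hs with hs | hs
        · exact hs.1.ne'
        · exact hs.2.ne
      have hst : t ≠ s := by
        rcases hs with hs | hs
        · exact hs.2.ne'
        · exact hs.1.ne
      have n1 : deriv f s ≠ 0 := fun h => hs0 (hmono.injOn hsI h0 (h.trans hf'0.symm))
      have n2 : deriv f t ≠ 0 := fun h => ht0 (hmono.injOn ht h0 (h.trans hf'0.symm))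
      have n3 : deriv f t - deriv f s ≠ 0 := fun h => hst (hmono.injOn ht hsI (sub_eq_zero.1 h))
      have hD : deriv f s * deriv f t * (deriv f t - deriv f s) ≠ 0 :=
        mul_ne_zero (mul_ne_zero n1 n2) n3
      have h := hUT s hsI t ht hs
      rw [abs_div, abs_of_nonneg (sq_nonneg _)] at h
      have hD' := abs_pos.2 hD
      have h2 : 2 * ((t - s) * deriv f t * deriv f s + f s * deriv f t - deriv f s * f t)^2 =
          |deriv f s * deriv f t * (deriv f t - deriv f s)| * |s * f t - t * f s| := by
        rw [mul_comm (deriv f s) (deriv f t)]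
        field_simp at h
        linear_combination h
      have e1 : (t - s) * deriv f t * (deriv f s / s) + (f s / s) * deriv f t
        - (deriv f s / s) * f t = ((t - s) * deriv f t * deriv f s + f s * deriv f t
          - deriv f s * f t) / s := by field_simp
      have e2 : deriv f s / s * deriv f t * (deriv f t - deriv f s) =
        (deriv f s * deriv f t * (deriv f t - deriv f s)) / s := by field_simp
      have e3 : f t - t * (f s / s) = (s * f t - t * f s) / s := by field_simp
      rw [e1, e2, e3, abs_div, abs_div, div_pow, ← sq_abs s, div_mul_div_comm, ← h2]
      ring
    have hlim := tendsto_nhds_unique (A.congr' E) B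
    have e4 : |c * deriv f t * (deriv f t - 0)| = c * (deriv f t)^2 := by
      rw [abs_of_nonneg]
      · ring
      · have : c * deriv f t * (deriv f t - 0) = c * (deriv f t)^2 := by ring
        rw [this]; positivity
    rw [e4, mul_zero, sub_zero, sub_zero, abs_of_nonneg hft] at hlim
    apply mul_left_cancel₀ hc.ne'
    linear_combination -hlim
  intro t ht
  rcases lt_trichotomy t 0 with h | h | h
  · refine key t ht h.ne ?_ (nhdsWithin 0 (Iio 0)) inferInstance
      (nhdsWithin_mono _ fun x hx => ne_of_lt hx) ?_
    · have hsub : ∀ x ∈ Icc t 0, x ∈ Set.Ioo p q := fun x hx =>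
        ⟨ht.1.trans_le hx.1, hx.2.trans_lt hq⟩
      obtain ⟨c, hc, hc2⟩ := exists_deriv_eq_slope f h
        (fun x hx => (hd x (hsub x hx)).continuousAt.continuousWithinAt)
        (fun x hx => (hd x (hsub x (Ioo_subset_Icc_self hx))).differentiableWithinAt)
      have := hmono (hsub c (Ioo_subset_Icc_self hc)) h0 hc.2
      rw [hf'0, hc2, hf0, div_lt_iff₀ (by linarith)] at this
      linarith
    · filter_upwards [Ioo_mem_nhdsLT h] with s hs
      exact Or.inr hs
  · subst h; simp [hf0]
  · refine key t ht h.ne' ?_ (nhdsWithin 0 (Ioi 0)) inferInstance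
      (nhdsWithin_mono _ fun x hx => ne_of_gt hx) ?_
    · have hsub : ∀ x ∈ Icc 0 t, x ∈ Set.Ioo p q := fun x hx =>
        ⟨hp.trans_le hx.1, hx.2.trans_lt ht.2⟩
      obtain ⟨c, hc, hc2⟩ := exists_deriv_eq_slope f h
        (fun x hx => (hd x (hsub x hx)).continuousAt.continuousWithinAt)
        (fun x hx => (hd x (hsub x (Ioo_subset_Icc_self hx))).differentiableWithinAt)
      have := hmono h0 (hsub c (Ioo_subset_Icc_self hc)) hc.1
      rw [hf'0, hc2, hf0, lt_div_iff₀ (by linarith)] at this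
      linarith
    · filter_upwards [Ioo_mem_nhdsGT h] with s hs
      exact Or.inl hs
end

section
/- Suppose that U(s,t) = T(s,t)/2 for all s, t ∈ I with 0 < s < t or t < s < 0. Then 2 f(t)² f''(t) = f'(t)²·(t f'(t) − f(t)) for every t ∈ I. -/
open Real Filter Set

theorem stmt_14 (p q : ℝ) (hp : p < 0) (hq : 0 < q)
    (f : ℝ → ℝ) (hf : ContDiffOn ℝ 3 f (Set.Ioo p q))
    (hf0 : f 0 = 0) (hf'0 : deriv f 0 = 0)
    (hconv : ∀ x ∈ Set.Ioo p q, 0 < deriv (deriv f) x)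
    (hUT : ∀ s ∈ Set.Ioo p q, ∀ t ∈ Set.Ioo p q, ((0 < s ∧ s < t) ∨ (t < s ∧ s < 0)) →
      (1/2) * |((t - s) * deriv f t * deriv f s + f s * deriv f t - deriv f s * f t)^2 /
          (deriv f s * deriv f t * (deriv f t - deriv f s))| =
        (|s * f t - t * f s| / 2) / 2) :
    ∀ t ∈ Set.Ioo p q,
      2 * (f t)^2 * deriv (deriv f) t = (deriv f t)^2 * (t * deriv f t - f t) := by
  have h0 : (0:ℝ) ∈ Ioo p q := ⟨hp, hq⟩
  have hd : ∀ x ∈ Ioo p q, HasDerivAt f (deriv f x) x := fun x hx =>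
    ((hf.differentiableOn (by norm_num)).differentiableAt (isOpen_Ioo.mem_nhds hx)).hasDerivAt
  have hdd : ∀ x ∈ Ioo p q, HasDerivAt (deriv f) (deriv (deriv f) x) x := fun x hx =>
    (differentiableAt_of_deriv_ne_zero (hconv x hx).ne').hasDerivAt
  have hmono : StrictMonoOn (deriv f) (Ioo p q) := by
    apply strictMonoOn_of_deriv_pos (convex_Ioo p q)
    · exact fun x hx => (hdd x hx).continuousAt.continuousWithinAt
    · intro x hx
      rw [interior_Ioo] at hx
      exact hconv x hx
  have hne : ∀ x ∈ Ioo p q, x ≠ 0 → deriv f x ≠ 0 := by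
    intro x hx hx0 h
    exact hx0 (hmono.injOn hx h0 (h.trans hf'0.symm))
  have hpos : ∀ x ∈ Ioo p q, x ≠ 0 → 0 < f x := by
    intro x hx hx0
    rcases lt_or_gt_of_ne hx0 with h | h
    · obtain ⟨y, hy, hy'⟩ := exists_hasDerivAt_eq_slope f (deriv f) h
        (fun z hz => (hd z ⟨hx.1.trans_le hz.1, hz.2.trans_lt hq⟩).continuousAt.continuousWithinAt)
        (fun z hz => hd z ⟨hx.1.trans hz.1, hz.2.trans hq⟩)
      have := hmono ⟨hx.1.trans hy.1, hy.2.trans hq⟩ h0 hy.2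
      rw [hf'0, hy', hf0, div_lt_iff₀ (by linarith)] at this
      linarith
    · obtain ⟨y, hy, hy'⟩ := exists_hasDerivAt_eq_slope f (deriv f) h
        (fun z hz => (hd z ⟨hp.trans_le hz.1, hz.2.trans_lt hx.2⟩).continuousAt.continuousWithinAt)
        (fun z hz => hd z ⟨hp.trans hz.1, hz.2.trans hx.2⟩)
      have := hmono h0 ⟨hp.trans hy.1, hy.2.trans hx.2⟩ hy.1
      rw [hf'0, hy', hf0, lt_div_iff₀ (by linarith)] at this
      linarith
  set c := deriv (deriv f) 0 with hc
  have hcpos : 0 < c := hconv 0 h0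
  -- the first-order equation
  have key : ∀ t ∈ Ioo p q, t ≠ 0 →
      2 * c * (t * deriv f t - f t)^2 = f t * (deriv f t)^2 := by
    intro t ht ht0
    have hlin : HasDerivAt (fun u : ℝ => u * t) t 0 := by
      simpa using (hasDerivAt_id (0:ℝ)).mul_const t
    have hA : HasDerivAt (fun u : ℝ => deriv f (u * t)) (c * t) 0 := by
      have h1 : HasDerivAt (deriv f) c (0 * t) := by rw [zero_mul]; exact hdd 0 h0
      exact h1.comp (0:ℝ) hlin
    have hB : HasDerivAt (fun u : ℝ => f (u * t)) 0 0 := by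
      have h1 : HasDerivAt f 0 (0 * t) := by
        have h2 := hd 0 h0
        rw [hf'0] at h2
        rwa [zero_mul]
      have h3 := h1.comp (0:ℝ) hlin
      rw [zero_mul] at h3
      exact h3
    have hA' : Tendsto (fun u : ℝ => deriv f (u * t) / u) (nhdsWithin 0 (Ioi 0))
        (nhds (c * t)) := by
      have := hA.tendsto_slope_zero_right
      simpa [hf'0, div_eq_inv_mul] using this
    have hB' : Tendsto (fun u : ℝ => f (u * t) / u) (nhdsWithin 0 (Ioi 0)) (nhds 0) := by
      have := hB.tendsto_slope_zero_right
      simpa [hf0, div_eq_inv_mul] using this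
    have hA0 : Tendsto (fun u : ℝ => deriv f (u * t)) (nhdsWithin 0 (Ioi 0)) (nhds 0) := by
      have := hA.continuousAt.tendsto.mono_left (nhdsWithin_le_nhds (s := Ioi (0:ℝ)))
      simpa [hf'0] using this
    have hu0 : Tendsto (fun u : ℝ => u) (nhdsWithin 0 (Ioi 0)) (nhds 0) :=
      tendsto_id.mono_left nhdsWithin_le_nhds
    have hL : Tendsto (fun u : ℝ => 2 * ((t - u * t) * deriv f t * (deriv f (u * t) / u)
          + (f (u * t) / u) * deriv f t - (deriv f (u * t) / u) * f t)^2)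
        (nhdsWithin 0 (Ioi 0))
        (nhds (2 * ((t - 0 * t) * deriv f t * (c * t) + 0 * deriv f t - (c * t) * f t)^2)) :=
      ((((((tendsto_const_nhds.sub (hu0.mul_const t)).mul_const _).mul hA').add
        (hB'.mul_const _)).sub (hA'.mul_const _)).pow 2).const_mul 2
    have hR : Tendsto (fun u : ℝ => |t * f t - t * (f (u * t) / u)| *
          |(deriv f (u * t) / u) * deriv f t * (deriv f t - deriv f (u * t))|)
        (nhdsWithin 0 (Ioi 0))
        (nhds (|t * f t - t * 0| * |(c * t) * deriv f t * (deriv f t - 0)|)) :=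
      ((tendsto_const_nhds.sub (hB'.const_mul t)).abs).mul
        ((hA'.mul_const _).mul (tendsto_const_nhds.sub hA0)).abs
    have hEq : (fun u : ℝ => 2 * ((t - u * t) * deriv f t * (deriv f (u * t) / u)
          + (f (u * t) / u) * deriv f t - (deriv f (u * t) / u) * f t)^2)
        =ᶠ[nhdsWithin 0 (Ioi 0)] (fun u : ℝ => |t * f t - t * (f (u * t) / u)| *
          |(deriv f (u * t) / u) * deriv f t * (deriv f t - deriv f (u * t))|) := by
      filter_upwards [Ioo_mem_nhdsGT (zero_lt_one' ℝ)] with u hu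
      obtain ⟨hu1, hu2⟩ := hu
      have hor : (0 < u * t ∧ u * t < t) ∨ (t < u * t ∧ u * t < 0) := by
        rcases lt_or_gt_of_ne ht0 with h | h
        · right; constructor <;> nlinarith
        · left; constructor <;> nlinarith
      have hs : u * t ∈ Ioo p q := by
        rcases hor with h | h
        · exact ⟨hp.trans h.1, h.2.trans ht.2⟩
        · exact ⟨ht.1.trans h.1, h.2.trans hq⟩
      have hst : u * t ≠ t := by rcases hor with h | h <;> [exact h.2.ne; exact h.1.ne']
      have hs0 : u * t ≠ 0 := mul_ne_zero hu1.ne' ht0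
      have h := hUT _ hs t ht hor
      have hden : deriv f (u * t) * deriv f t * (deriv f t - deriv f (u * t)) ≠ 0 :=
        mul_ne_zero (mul_ne_zero (hne _ hs hs0) (hne _ ht ht0))
          (sub_ne_zero.2 fun e => hst (hmono.injOn hs ht e.symm))
      rw [abs_div, abs_of_nonneg (sq_nonneg _)] at h
      have hden' := abs_pos.2 hden
      have h2 : 2 * ((t - u * t) * deriv f t * deriv f (u * t) + f (u * t) * deriv f t
          - deriv f (u * t) * f t)^2 = |u * t * f t - t * f (u * t)| *
          |deriv f (u * t) * deriv f t * (deriv f t - deriv f (u * t))| := by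
        rw [← mul_div_assoc, div_eq_iff hden'.ne'] at h
        linarith
      have e1 : t * f t - t * (f (u * t) / u) = (u * t * f t - t * f (u * t)) / u := by
        field_simp
      have e2 : (deriv f (u * t) / u) * deriv f t * (deriv f t - deriv f (u * t)) =
        (deriv f (u * t) * deriv f t * (deriv f t - deriv f (u * t))) / u := by
        field_simp
      have e3 : (t - u * t) * deriv f t * (deriv f (u * t) / u)
          + (f (u * t) / u) * deriv f t - (deriv f (u * t) / u) * f t =
          ((t - u * t) * deriv f t * deriv f (u * t) + f (u * t) * deriv f t
          - deriv f (u * t) * f t) / u := by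
        field_simp
      rw [e1, e2, e3, abs_div, abs_div, abs_of_pos hu1, div_pow, div_mul_div_comm, ← h2]
      ring
    have hlim := tendsto_nhds_unique (hL.congr' hEq) hR
    rw [← abs_mul] at hlim
    have e4 : (t * f t - t * 0) * (c * t * deriv f t * (deriv f t - 0)) =
        (c * t^2) * (f t * (deriv f t)^2) := by ring
    have hct : 0 < c * t^2 := by positivity
    rw [e4, abs_of_nonneg (mul_nonneg hct.le (mul_nonneg (hpos t ht ht0).le (sq_nonneg _)))] at hlim
    apply mul_left_cancel₀ hct.ne'
    rw [← hlim]
    ring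
  intro t ht
  by_cases ht0 : t = 0
  · subst ht0; simp [hf0, hf'0]
  have hk := key t ht ht0
  have hev : (fun x => 2 * c * (x * deriv f x - f x)^2) =ᶠ[nhds t]
      (fun x => f x * (deriv f x)^2) := by
    filter_upwards [isOpen_Ioo.mem_nhds ht, isOpen_ne.mem_nhds ht0] with x hx hx0
    exact key x hx hx0
  have d1 := (((((hasDerivAt_id t).mul (hdd t ht)).sub (hd t ht)).pow 2).const_mul (2 * c))
  have d2 := (hd t ht).mul ((hdd t ht).pow 2)
  have e := d1.unique (d2.congr_of_eventuallyEq hev)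
  simp at e
  have hF' := hne t ht ht0
  apply mul_left_cancel₀ hF'
  linear_combination (t * deriv f t - f t) * e - 2 * t * deriv (deriv f) t * hk
end

section
/- Suppose that f satisfies both identities f(t)·f'(t)² = 4a·(t f'(t) − f(t))² and 2 f(t)² f''(t) = f'(t)²·(t f'(t) − f(t)) for all t ∈ I, where a = f''(0)/2. Then for every t ∈ I with t > 0 one has f''(t) = f'(t)³ / (4√a · f(t)^{3/2}). -/
open Real Filter Set

theorem stmt_15 (p q : ℝ) (hp : p < 0) (hq : 0 < q)
    (f : ℝ → ℝ) (hf : ContDiffOn ℝ 3 f (Set.Ioo p q))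
    (hf0 : f 0 = 0) (hf'0 : deriv f 0 = 0)
    (hconv : ∀ x ∈ Set.Ioo p q, 0 < deriv (deriv f) x)
    (h1 : ∀ t ∈ Set.Ioo p q,
      f t * (deriv f t)^2 = 4 * (deriv (deriv f) 0 / 2) * (t * deriv f t - f t)^2)
    (h2 : ∀ t ∈ Set.Ioo p q,
      2 * (f t)^2 * deriv (deriv f) t = (deriv f t)^2 * (t * deriv f t - f t)) :
    ∀ t ∈ Set.Ioo p q, 0 < t →
      deriv (deriv f) t =
        (deriv f t)^3 / (4 * Real.sqrt (deriv (deriv f) 0 / 2) * (f t) ^ ((3:ℝ)/2)) := by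

  intro t ht htpos
  have hc' : ContinuousOn (deriv f) (Set.Ioo p q) := fun x hx =>
    (differentiableAt_of_deriv_ne_zero (hconv x hx).ne').continuousAt.continuousWithinAt
  have hm : StrictMonoOn (deriv f) (Set.Ioo p q) := by
    apply strictMonoOn_of_deriv_pos (convex_Ioo p q) hc'
    intro x hx
    rw [interior_Ioo] at hx
    exact hconv x hx
  have hd : ∀ x ∈ Set.Ioo p q, 0 < x → 0 < deriv f x := by
    intro x hx hx0
    have := hm ⟨hp, hq⟩ hx hx0
    rwa [hf'0] at this
  have hsub : Set.Icc 0 t ⊆ Set.Ioo p q := fun x hx =>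
    ⟨lt_of_lt_of_le hp hx.1, lt_of_le_of_lt hx.2 ht.2⟩
  have hm2 : StrictMonoOn f (Set.Icc 0 t) := by
    apply strictMonoOn_of_deriv_pos (convex_Icc 0 t) (hf.continuousOn.mono hsub)
    intro x hx
    rw [interior_Icc] at hx
    exact hd x (hsub ⟨hx.1.le, hx.2.le⟩) hx.1
  have hF : 0 < f t := by
    have := hm2 (Set.left_mem_Icc.2 htpos.le) (Set.right_mem_Icc.2 htpos.le) htpos
    rwa [hf0] at this
  have hD := hd t ht htpos
  have hC := hconv t ht
  have hA : 0 < deriv (deriv f) 0 / 2 := half_pos (hconv 0 ⟨hp, hq⟩)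
  have e1 := h1 t ht
  have e2 := h2 t ht
  generalize deriv (deriv f) 0 / 2 = a at *
  generalize deriv (deriv f) t = C at *
  generalize t * deriv f t - f t = g at *
  generalize deriv f t = D at *
  generalize f t = F at *
  have hg : 0 < g := by
    have h : 0 < D ^ 2 * g := by rw [← e2]; positivity
    exact pos_of_mul_pos_right h (by positivity)
  have hr : F ^ ((3:ℝ)/2) = F * √F := by
    rw [show (3:ℝ)/2 = 1 + 1/2 by norm_num, Real.rpow_add hF, Real.rpow_one, Real.sqrt_eq_rpow]
  rw [hr]
  have hs : 0 < √F := Real.sqrt_pos.2 hF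
  have hb : 0 < √a := Real.sqrt_pos.2 hA
  have hs2 : √F ^ 2 = F := Real.sq_sqrt hF.le
  have hb2 : √a ^ 2 = a := Real.sq_sqrt hA.le
  generalize √F = s at *
  generalize √a = b at *
  have key : s * D = 2 * b * g := by
    have : (s * D) ^ 2 = (2 * b * g) ^ 2 := by
      rw [mul_pow, hs2, e1, ← hb2]; ring
    exact (pow_left_inj₀ (by positivity) (by positivity) two_ne_zero).1 this
  rw [eq_div_iff (by positivity)]
  have hne : s * F ≠ 0 := by positivity
  apply mul_left_cancel₀ hs.ne'
  subst hs2
  linear_combination 2 * b * e2 - D ^ 2 * key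
end

section
/- Let a > 0 and b > 0, and let f : (0,b) → ℝ be a C² function with f(t) > 0 and f'(t) > 0 for all t ∈ (0,b), satisfying the differential equation f''(t) = f'(t)³ / (4√a · f(t)^{3/2}) on (0,b), and such that f(t) → 0 as t → 0⁺. Then there exists a constant c ∈ ℝ such that √a · t = √(f(t)) + c · f(t) for all t ∈ (0,b). -/
open Real Filter Set

theorem const_aux (b : ℝ) (g : ℝ → ℝ) (h : ∀ t ∈ Set.Ioo 0 b, HasDerivAt g 0 t) :
    ∀ x ∈ Set.Ioo 0 b, ∀ y ∈ Set.Ioo 0 b, g x = g y := by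
  intro x hx y hy
  exact isOpen_Ioo.is_const_of_deriv_eq_zero isPreconnected_Ioo
    (fun t ht => (h t ht).differentiableAt.differentiableWithinAt)
    (fun t ht => (h t ht).deriv) hx hy

theorem stmt_16 (a b : ℝ) (ha : 0 < a) (hb : 0 < b)
    (f : ℝ → ℝ) (hf : ContDiffOn ℝ 2 f (Set.Ioo 0 b))
    (hfpos : ∀ t ∈ Set.Ioo 0 b, 0 < f t)
    (hf'pos : ∀ t ∈ Set.Ioo 0 b, 0 < deriv f t)
    (hode : ∀ t ∈ Set.Ioo 0 b,
      deriv (deriv f) t = (deriv f t)^3 / (4 * Real.sqrt a * (f t) ^ ((3:ℝ)/2)))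
    (hlim : Filter.Tendsto f (nhdsWithin 0 (Set.Ioi 0)) (nhds 0)) :
    ∃ c : ℝ, ∀ t ∈ Set.Ioo 0 b, Real.sqrt a * t = Real.sqrt (f t) + c * f t := by
  have hA : 0 < √a := Real.sqrt_pos.2 ha
  have hd : ∀ t ∈ Set.Ioo 0 b, HasDerivAt f (deriv f t) t := fun t ht =>
    ((hf.differentiableOn (by norm_num)).differentiableAt (isOpen_Ioo.mem_nhds ht)).hasDerivAt
  have hf1 : ContDiffOn ℝ 1 (deriv f) (Set.Ioo 0 b) :=
    hf.deriv_of_isOpen isOpen_Ioo (by norm_num)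
  have hdd : ∀ t ∈ Set.Ioo 0 b, HasDerivAt (deriv f) (deriv (deriv f) t) t := fun t ht =>
    ((hf1.differentiableOn (by norm_num)).differentiableAt (isOpen_Ioo.mem_nhds ht)).hasDerivAt
  have hs : ∀ t ∈ Set.Ioo 0 b, HasDerivAt (fun t => √(f t)) (deriv f t / (2 * √(f t))) t :=
    fun t ht => (hd t ht).sqrt (hfpos t ht).ne'
  have hpow : ∀ t ∈ Set.Ioo 0 b, (f t) ^ ((3:ℝ)/2) = (√(f t))^3 := by
    intro t ht
    rw [Real.sqrt_eq_rpow, ← Real.rpow_natCast, ← Real.rpow_mul (hfpos t ht).le]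
    norm_num
  have hg := const_aux b (fun t => (deriv f t)⁻¹ - (2 * √a * √(f t))⁻¹) (by
    intro t ht
    have h1 := hfpos t ht
    have h2 := hf'pos t ht
    have h3 : 0 < √(f t) := Real.sqrt_pos.2 h1
    have h := ((hdd t ht).inv h2.ne').sub (((hs t ht).const_mul (2 * √a)).inv (by positivity))
    refine h.congr_deriv ?_
    rw [hode t ht, hpow t ht]
    field_simp
    ring)
  have hm : b / 2 ∈ Set.Ioo 0 b := ⟨by linarith, by linarith⟩
  obtain ⟨C, hC⟩ : ∃ C : ℝ, ∀ t ∈ Set.Ioo 0 b, (deriv f t)⁻¹ - (2 * √a * √(f t))⁻¹ = C :=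
    ⟨_, fun t ht => hg t ht _ hm⟩
  have hh := const_aux b (fun t => √a * t - √(f t) - √a * C * f t) (by
    intro t ht
    have h1 := hfpos t ht
    have h2 := hf'pos t ht
    have h3 : 0 < √(f t) := Real.sqrt_pos.2 h1
    have h := (((hasDerivAt_id t).const_mul √a).sub (hs t ht)).sub
      ((hd t ht).const_mul (√a * C))
    refine h.congr_deriv ?_
    rw [← hC t ht]
    field_simp
    ring)
  refine ⟨√a * C, fun t ht => ?_⟩
  have hl : Tendsto (fun t => √a * t - √(f t) - √a * C * f t) (nhdsWithin 0 (Set.Ioi 0))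
      (nhds (√a * 0 - √0 - √a * C * 0)) := by
    refine Tendsto.sub (Tendsto.sub ?_ ?_) (hlim.const_mul _)
    · exact (tendsto_id.mono_left nhdsWithin_le_nhds).const_mul _
    · exact (Real.continuous_sqrt.tendsto 0).comp hlim
  have hl2 : Tendsto (fun t => √a * t - √(f t) - √a * C * f t) (nhdsWithin 0 (Set.Ioi 0))
      (nhds (√a * t - √(f t) - √a * C * f t)) := by
    refine tendsto_const_nhds.congr' ?_
    filter_upwards [Ioo_mem_nhdsGT hb] with x hx
    exact hh t ht x hx
  have := tendsto_nhds_unique hl hl2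
  simp at this
  linarith
end

section
/- Let a > 0 and c > 0, and define f on the open interval I = (−1/(4√a c), ∞) by f(x) = (2√a c x + 1 − √(4√a c x + 1)) / (2c²). Then f(0) = 0, f'(0) = 0, f''(0) = 2a, f'''(0) = −12 a √a c, f''(x) > 0 for all x ∈ I (so f is strictly convex), and the graph of f lies on the parabola a x² − 2√a c x y + c² y² − y = 0; that is, a x² − 2√a c x f(x) + c² f(x)² − f(x) = 0 for all x ∈ I. -/
open Real Filter Set

theorem stmt_17 (a c : ℝ) (ha : 0 < a) (hc : 0 < c)
    (f : ℝ → ℝ)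
    (hf : ∀ x ∈ Set.Ioi (-(1 / (4 * Real.sqrt a * c))),
      f x = (2 * Real.sqrt a * c * x + 1 - Real.sqrt (4 * Real.sqrt a * c * x + 1)) /
        (2 * c^2)) :
    f 0 = 0 ∧ deriv f 0 = 0 ∧ deriv (deriv f) 0 = 2 * a ∧
    deriv (deriv (deriv f)) 0 = -(12 * a * Real.sqrt a * c) ∧
    (∀ x ∈ Set.Ioi (-(1 / (4 * Real.sqrt a * c))), 0 < deriv (deriv f) x) ∧
    (∀ x ∈ Set.Ioi (-(1 / (4 * Real.sqrt a * c))),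
      a * x^2 - 2 * Real.sqrt a * c * x * f x + c^2 * (f x)^2 - f x = 0) := by 
  set s := Real.sqrt a with hs
  have hs0 : 0 < s := Real.sqrt_pos.mpr ha
  have hsa : a = s ^ 2 := (Real.sq_sqrt ha.le).symm
  clear_value s
  subst hsa
  have hk : 0 < 4 * s * c := by positivity
  have hpos : ∀ x ∈ Set.Ioi (-(1 / (4 * s * c))), 0 < 4 * s * c * x + 1 := by
    intro x hx
    have h1 : -(1 / (4 * s * c)) < x := hx
    have h2 := mul_lt_mul_of_pos_left h1 hk
    have h3 : 4 * s * c * -(1 / (4 * s * c)) = -1 := by field_simp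
    linarith
  have h0 : (0 : ℝ) ∈ Set.Ioi (-(1 / (4 * s * c))) := by
    have : 0 < 1 / (4 * s * c) := by positivity
    simp only [Set.mem_Ioi]
    linarith
  have hg : ∀ x ∈ Set.Ioi (-(1 / (4 * s * c))),
      HasDerivAt (fun x => Real.sqrt (4 * s * c * x + 1))
        (4 * s * c / (2 * Real.sqrt (4 * s * c * x + 1))) x := by
    intro x hx
    have h1 : HasDerivAt (fun x : ℝ => 4 * s * c * x + 1) (4 * s * c) x := by
      simpa using ((hasDerivAt_id x).const_mul (4 * s * c)).add_const 1
    exact h1.sqrt (hpos x hx).ne'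
  have hgp : ∀ x ∈ Set.Ioi (-(1 / (4 * s * c))), 0 < Real.sqrt (4 * s * c * x + 1) :=
    fun x hx => Real.sqrt_pos.mpr (hpos x hx)
  have key : ∀ (F G : ℝ → ℝ) (G' : ℝ),
      (∀ x ∈ Set.Ioi (-(1 / (4 * s * c))), F x = G x) →
      ∀ x ∈ Set.Ioi (-(1 / (4 * s * c))), HasDerivAt G G' x → deriv F x = G' := by
    intro F G G' h x hx hG
    have : F =ᶠ[nhds x] G := by
      filter_upwards [isOpen_Ioi.mem_nhds hx] with y hy using h y hy
    rw [this.deriv_eq, hG.deriv]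
  have d1 : ∀ x ∈ Set.Ioi (-(1 / (4 * s * c))),
      deriv f x = (s / c) * (1 - (Real.sqrt (4 * s * c * x + 1))⁻¹) := by
    intro x hx
    refine key _ _ _ hf x hx ?_
    have h1 : HasDerivAt (fun x : ℝ => 2 * s * c * x + 1) (2 * s * c) x := by
      simpa using ((hasDerivAt_id x).const_mul (2 * s * c)).add_const 1
    have h2 := (h1.sub (hg x hx)).div_const (2 * c ^ 2)
    have h3 := hgp x hx
    refine h2.congr_deriv ?_
    field_simp
    try ring
  have d2 : ∀ x ∈ Set.Ioi (-(1 / (4 * s * c))),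
      deriv (deriv f) x = 2 * s ^ 2 * ((Real.sqrt (4 * s * c * x + 1)) ^ 3)⁻¹ := by
    intro x hx
    have h3 := hgp x hx
    refine key _ _ _ d1 x hx ?_
    have h2 := (((hg x hx).fun_inv h3.ne').const_sub 1).const_mul (s / c)
    refine h2.congr_deriv ?_
    field_simp
    try ring
  have d3 : ∀ x ∈ Set.Ioi (-(1 / (4 * s * c))),
      deriv (deriv (deriv f)) x
        = -(12 * s ^ 2 * s * c) * ((Real.sqrt (4 * s * c * x + 1)) ^ 5)⁻¹ := by
    intro x hx
    have h3 := hgp x hx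
    refine key _ _ _ d2 x hx ?_
    have h2 := (((hg x hx).fun_pow 3).fun_inv (pow_pos h3 3).ne').const_mul (2 * s ^ 2)
    refine h2.congr_deriv ?_
    simp only [Nat.reduceSub, Nat.cast_ofNat]
    field_simp
    try ring
  refine ⟨?_, ?_, ?_, ?_, ?_, ?_⟩
  · rw [hf 0 h0]; simp
  · rw [d1 0 h0]; simp
  · rw [d2 0 h0]; simp
  · rw [d3 0 h0]; simp
  · intro x hx
    have h3 := hgp x hx
    rw [d2 x hx]
    positivity
  · intro x hx
    have h4 := Real.sq_sqrt (hpos x hx).le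
    rw [hf x hx]
    set g := Real.sqrt (4 * s * c * x + 1)
    have hx' : x = (g ^ 2 - 1) / (4 * s * c) := by
      rw [h4]; field_simp; ring
    clear_value g
    subst hx'
    field_simp
    ring
end

section
/- Suppose that U(s,t) = T(s,t)/2 for all s, t ∈ I with 0 < s < t or t < s < 0. Then, setting c := −f'''(0)/(12 a √a) with a = f''(0)/2, the graph of f lies on the parabola a x² − 2√a c x y + c² y² − y = 0; that is, a x² − 2√a c x f(x) + c² f(x)² − f(x) = 0 for every x ∈ I. -/
open Real Filter Set
open scoped Topology

lemma pos_side (q a b : ℝ) (ha : 0 < a) (f f1 f2 : ℝ → ℝ)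
    (h1 : ∀ x ∈ Ico 0 q, HasDerivAt f (f1 x) x)
    (h2 : ∀ x ∈ Ico 0 q, HasDerivAt f1 (f2 x) x)
    (h20 : f2 0 = 2 * a) (h3 : HasDerivAt f2 (6 * b) 0)
    (hf0 : f 0 = 0) (hf10 : f1 0 = 0)
    (hpos : ∀ x ∈ Ico 0 q, 0 < f2 x)
    (hUT : ∀ s t, 0 < s → s < t → t < q →
      (1/2) * |((t - s) * f1 t * f1 s + f s * f1 t - f1 s * f t)^2 /
          (f1 s * f1 t * (f1 t - f1 s))| =
        (|s * f t - t * f s| / 2) / 2) :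
    ∀ x ∈ Ioo 0 q, a * x^2 + b / a * x * f x + b^2 / (4 * a^3) * (f x)^2 - f x = 0 := by
  intro x0 hx0
  have hq : 0 < q := hx0.1.trans hx0.2
  have mem0 : (0:ℝ) ∈ Ico 0 q := ⟨le_rfl, hq⟩
  have hmono : StrictMonoOn f1 (Ico 0 q) := by
    apply strictMonoOn_of_deriv_pos (convex_Ico 0 q)
    · exact fun x hx => (h2 x hx).continuousAt.continuousWithinAt
    · intro x hx
      rw [interior_Ico] at hx
      rw [(h2 x ⟨hx.1.le, hx.2⟩).deriv]
      exact hpos x ⟨hx.1.le, hx.2⟩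
  have hf1pos : ∀ x ∈ Ioo 0 q, 0 < f1 x := fun x hx => by
    have := hmono mem0 ⟨hx.1.le, hx.2⟩ hx.1
    rwa [hf10] at this
  have hmvt : ∀ x ∈ Ioo 0 q, 0 < f x ∧ 0 < x * f1 x - f x := by
    intro x hx
    obtain ⟨c, hc, hce⟩ := exists_hasDerivAt_eq_slope f f1 hx.1
      (fun y hy => (h1 y ⟨hy.1, hy.2.trans_lt hx.2⟩).continuousAt.continuousWithinAt)
      (fun y hy => h1 y ⟨hy.1.le, hy.2.trans hx.2⟩)
    rw [hf0, sub_zero, sub_zero, eq_div_iff hx.1.ne'] at hce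
    have hcp := hf1pos c ⟨hc.1, hc.2.trans hx.2⟩
    have hlt := hmono ⟨hc.1.le, hc.2.trans hx.2⟩ ⟨hx.1.le, hx.2⟩ hc.2
    have := hx.1
    constructor
    · rw [← hce]; positivity
    · rw [← hce]; nlinarith
  -- limits at 0
  have hs0 : Tendsto (fun s : ℝ => s) (𝓝[>] 0) (𝓝 0) := nhdsWithin_le_nhds
  have hIoo : ∀ᶠ s in 𝓝[>] (0:ℝ), s ∈ Ioo 0 q := Ioo_mem_nhdsGT hq
  have L1 : Tendsto (fun s => f1 s / s) (𝓝[>] 0) (𝓝 (2 * a)) := by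
    have := (h2 0 mem0).tendsto_slope.mono_left (nhdsGT_le_nhdsNE 0)
    rw [h20] at this
    refine this.congr fun s => ?_
    simp [slope_def_field, hf10]
  have L2 : Tendsto (fun s => (f2 s - 2 * a) / (6 * s)) (𝓝[>] 0) (𝓝 b) := by
    have := h3.tendsto_slope.mono_left (nhdsGT_le_nhdsNE 0)
    have := this.div_const 6
    rw [show 6 * b / 6 = b by ring] at this
    refine this.congr fun s => ?_
    simp [slope_def_field, h20]
    rw [div_div, mul_comm s 6]
  have cf : Tendsto f (𝓝[>] 0) (𝓝 0) := by
    have := (h1 0 mem0).continuousAt.tendsto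
    rw [hf0] at this
    exact this.mono_left nhdsWithin_le_nhds
  have cf1 : Tendsto f1 (𝓝[>] 0) (𝓝 0) := by
    have := (h2 0 mem0).continuousAt.tendsto
    rw [hf10] at this
    exact this.mono_left nhdsWithin_le_nhds
  have L3 : Tendsto (fun s => (f1 s - 2 * a * s) / (3 * s^2)) (𝓝[>] 0) (𝓝 b) := by
    refine HasDerivAt.lhopital_zero_nhdsGT (f' := fun s => f2 s - 2 * a) (g' := fun s => 6 * s)
      ?_ ?_ ?_ ?_ ?_ L2
    · filter_upwards [hIoo] with s hs
      exact ((h2 s ⟨hs.1.le, hs.2⟩).sub ((hasDerivAt_id s).const_mul (2 * a))).congr_deriv (by simp)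
    · filter_upwards [hIoo] with s hs
      exact (((hasDerivAt_id s).pow 2).const_mul 3).congr_deriv (by simp; ring)
    · filter_upwards [hIoo] with s hs
      have := hs.1
      positivity
    · simpa using cf1.sub (hs0.const_mul (2 * a))
    · simpa using (hs0.pow 2).const_mul 3
  have L4 : Tendsto (fun s => (f s - a * s^2) / s^3) (𝓝[>] 0) (𝓝 b) := by
    refine HasDerivAt.lhopital_zero_nhdsGT (f' := fun s => f1 s - 2 * a * s)
      (g' := fun s => 3 * s^2) ?_ ?_ ?_ ?_ ?_ L3
    · filter_upwards [hIoo] with s hs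
      exact ((h1 s ⟨hs.1.le, hs.2⟩).sub (((hasDerivAt_id s).pow 2).const_mul a)).congr_deriv
        (by simp; ring)
    · filter_upwards [hIoo] with s hs
      exact ((hasDerivAt_id s).pow 3).congr_deriv (by simp)
    · filter_upwards [hIoo] with s hs
      have := hs.1
      positivity
    · simpa using cf.sub ((hs0.pow 2).const_mul a)
    · simpa using (hs0.pow 3)
  have L5 : Tendsto (fun s => f s / s^2) (𝓝[>] 0) (𝓝 a) := by
    have := (hs0.mul L4).const_add a
    rw [zero_mul, add_zero] at this
    refine this.congr' ?_
    filter_upwards [hIoo] with s hs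
    have := hs.1.ne'
    field_simp
    ring
  -- the ODE
  have ode : ∀ t ∈ Ioo 0 q, 4 * a * (t * f1 t - f t)^2 = (f1 t)^2 * f t := by
    intro t ht
    have hPt := hf1pos t ht
    have hFt := (hmvt t ht).1
    have A : Tendsto (fun s => 2 * ((t - s) * f1 t * (f1 s / s) + (f s / s^2) * s * f1 t
        - (f1 s / s) * f t)^2) (𝓝[>] 0)
        (𝓝 (2 * ((t - 0) * f1 t * (2 * a) + a * 0 * f1 t - (2 * a) * f t)^2)) :=
      ((((((hs0.const_sub t).mul_const _).mul L1).add ((L5.mul hs0).mul_const _)).sub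
        (L1.mul_const _)).pow 2).const_mul 2
    have B : Tendsto (fun s => |(f1 s / s) * f1 t * (f1 t - f1 s)| *
        |f t - t * ((f s / s^2) * s)|) (𝓝[>] 0)
        (𝓝 (|2 * a * f1 t * (f1 t - 0)| * |f t - t * (a * 0)|)) :=
      (((L1.mul_const _).mul (cf1.const_sub _)).abs).mul
        (((L5.mul hs0).const_mul t).const_sub _).abs
    have E : (fun s => 2 * ((t - s) * f1 t * (f1 s / s) + (f s / s^2) * s * f1 t
        - (f1 s / s) * f t)^2) =ᶠ[𝓝[>] 0] (fun s => |(f1 s / s) * f1 t * (f1 t - f1 s)| *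
        |f t - t * ((f s / s^2) * s)|) := by
      filter_upwards [Ioo_mem_nhdsGT ht.1] with s hs
      have hs1 := hs.1
      have h := hUT s t hs.1 hs.2 ht.2
      have hPs := hf1pos s ⟨hs.1, hs.2.trans ht.2⟩
      have hd : 0 < f1 t - f1 s :=
        sub_pos.2 (hmono ⟨hs.1.le, hs.2.trans ht.2⟩ ⟨ht.1.le, ht.2⟩ hs.2)
      have hD : 0 < f1 s * f1 t * (f1 t - f1 s) := by positivity
      rw [abs_div, abs_of_pos hD, abs_of_nonneg (sq_nonneg _)] at h
      have h' : 2 * ((t - s) * f1 t * f1 s + f s * f1 t - f1 s * f t)^2 =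
          f1 s * f1 t * (f1 t - f1 s) * |s * f t - t * f s| := by
        field_simp at h
        linarith
      have e1 : (t - s) * f1 t * (f1 s / s) + (f s / s^2) * s * f1 t - (f1 s / s) * f t =
          ((t - s) * f1 t * f1 s + f s * f1 t - f1 s * f t) / s := by
        field_simp
      have e2 : f t - t * ((f s / s^2) * s) = (s * f t - t * f s) / s := by
        field_simp
      have e3 : 0 < f1 s / s * f1 t * (f1 t - f1 s) := by positivity
      rw [e1, e2, abs_of_pos e3, abs_div, abs_of_pos hs1, div_pow, ← mul_div_assoc, h']
      field_simp
    have := tendsto_nhds_unique_of_eventuallyEq A B E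
    rw [sub_zero, sub_zero, mul_zero, mul_zero, sub_zero, abs_of_pos hFt,
      abs_of_pos (by positivity)] at this
    have h2a : (2 * a) * (4 * a * (t * f1 t - f t)^2) = (2 * a) * ((f1 t)^2 * f t) := by
      linarith
    exact mul_left_cancel₀ (by positivity) h2a
  -- constancy
  set g : ℝ → ℝ := fun t => (t - √(f t) / √a) / f t with hg
  have hra : 0 < √a := Real.sqrt_pos.2 ha
  have hra2 : √a ^ 2 = a := Real.sq_sqrt ha.le
  have hder : ∀ t ∈ Ioo 0 q, HasDerivAt g 0 t := by
    intro t ht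
    obtain ⟨hF, hN⟩ := hmvt t ht
    have hP := hf1pos t ht
    have hy : 0 < √(f t) := Real.sqrt_pos.2 hF
    have hy2 : √(f t) ^ 2 = f t := Real.sq_sqrt hF.le
    have key : 2 * √a * (t * f1 t - f t) = f1 t * √(f t) := by
      have : (2 * √a * (t * f1 t - f t))^2 = (f1 t * √(f t))^2 := by
        rw [mul_pow, mul_pow, mul_pow, hra2, hy2, ← ode t ht]; ring
      exact (sq_eq_sq₀ (by positivity) (by positivity)).1 this
    have d := h1 t ⟨ht.1.le, ht.2⟩
    have d2 := ((hasDerivAt_id t).sub ((d.sqrt hF.ne').div_const √a)).div d hF.ne'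
    refine HasDerivAt.congr_deriv d2 ?_
    rw [div_eq_zero_iff]
    left
    simp only [id, Pi.sub_apply]
    generalize √(f t) = y at *
    generalize √a = r at *
    rw [← hy2] at key ⊢
    field_simp
    linear_combination (-1) * key
  have hconst : ∀ t ∈ Ioo 0 q, g t = g x0 := fun t ht =>
    isOpen_Ioo.is_const_of_deriv_eq_zero isPreconnected_Ioo
      (fun y hy => (hder y hy).differentiableAt.differentiableWithinAt)
      (fun y hy => (hder y hy).deriv) ht hx0
  have Lg : Tendsto g (𝓝[>] 0) (𝓝 (-b / (a * a * (1 + √a / √a)))) := by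
    have : Tendsto (fun s => -((f s - a * s^2) / s^3) /
        (a * (f s / s^2) * (1 + √(f s / s^2) / √a))) (𝓝[>] 0)
        (𝓝 (-b / (a * a * (1 + √a / √a)))) := by
      refine L4.neg.div ((L5.const_mul a).mul ((L5.sqrt.div_const _).const_add 1)) ?_
      positivity
    refine this.congr' ?_
    filter_upwards [hIoo] with s hs
    have hs1 := hs.1
    obtain ⟨hF, hN⟩ := hmvt s hs
    have hy : 0 < √(f s) := Real.sqrt_pos.2 hF
    have hy2 : √(f s) ^ 2 = f s := Real.sq_sqrt hF.le
    rw [Real.sqrt_div hF.le, Real.sqrt_sq hs1.le]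
    simp only [hg]
    generalize √(f s) = y at *
    generalize √a = r at *
    rw [← hy2, ← hra2]
    have : r * s + y ≠ 0 := by positivity
    field_simp
    ring
  have hgx : g x0 = -b / (2 * a^2) := by
    have h : Tendsto g (𝓝[>] 0) (𝓝 (g x0)) := by
      refine tendsto_const_nhds.congr' ?_
      filter_upwards [hIoo] with s hs
      exact (hconst s hs).symm
    rw [tendsto_nhds_unique h Lg, div_self hra.ne']
    ring
  have hF := (hmvt x0 hx0).1
  have hy2 : √(f x0) ^ 2 = f x0 := Real.sq_sqrt hF.le
  simp only [hg] at hgx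
  rw [div_eq_iff hF.ne'] at hgx
  have e : √(f x0) / √a = x0 + b / (2 * a^2) * f x0 := by linear_combination -hgx
  have e2 : f x0 / a = (x0 + b / (2 * a^2) * f x0)^2 := by
    rw [← e, div_pow, hy2, hra2]
  have e3 : f x0 = a * (x0 + b / (2 * a^2) * f x0)^2 := by
    rw [← e2]; field_simp
  have e4 : a * (x0 + b / (2 * a^2) * f x0)^2 =
      a * x0^2 + b / a * x0 * f x0 + b^2 / (4 * a^3) * (f x0)^2 := by
    field_simp; ring
  linarith

theorem stmt_18 (p q : ℝ) (hp : p < 0) (hq : 0 < q)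
    (f : ℝ → ℝ) (hf : ContDiffOn ℝ 3 f (Set.Ioo p q))
    (hf0 : f 0 = 0) (hf'0 : deriv f 0 = 0)
    (hconv : ∀ x ∈ Set.Ioo p q, 0 < deriv (deriv f) x)
    (hUT : ∀ s ∈ Set.Ioo p q, ∀ t ∈ Set.Ioo p q, ((0 < s ∧ s < t) ∨ (t < s ∧ s < 0)) →
      (1/2) * |((t - s) * deriv f t * deriv f s + f s * deriv f t - deriv f s * f t)^2 /
          (deriv f s * deriv f t * (deriv f t - deriv f s))| =
        (|s * f t - t * f s| / 2) / 2) :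
    ∀ x ∈ Set.Ioo p q,
      (deriv (deriv f) 0 / 2) * x^2 -
        2 * Real.sqrt (deriv (deriv f) 0 / 2) *
          (-(deriv (deriv (deriv f)) 0) /
            (12 * (deriv (deriv f) 0 / 2) * Real.sqrt (deriv (deriv f) 0 / 2))) * x * f x +
        (-(deriv (deriv (deriv f)) 0) /
            (12 * (deriv (deriv f) 0 / 2) * Real.sqrt (deriv (deriv f) 0 / 2)))^2 * (f x)^2 -
        f x = 0 := by
  have o : IsOpen (Ioo p q) := isOpen_Ioo
  have c1 : ContDiffOn ℝ 2 (deriv f) (Ioo p q) := hf.deriv_of_isOpen o (by norm_num)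
  have c2 : ContDiffOn ℝ 1 (deriv (deriv f)) (Ioo p q) := c1.deriv_of_isOpen o (by norm_num)
  have d1 : ∀ x ∈ Ioo p q, HasDerivAt f (deriv f x) x := fun x hx =>
    ((hf.differentiableOn (by norm_num)).differentiableAt (o.mem_nhds hx)).hasDerivAt
  have d2 : ∀ x ∈ Ioo p q, HasDerivAt (deriv f) (deriv (deriv f) x) x := fun x hx =>
    ((c1.differentiableOn (by norm_num)).differentiableAt (o.mem_nhds hx)).hasDerivAt
  have d3 : ∀ x ∈ Ioo p q, HasDerivAt (deriv (deriv f)) (deriv (deriv (deriv f)) x) x :=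
    fun x hx =>
    ((c2.differentiableOn (by norm_num)).differentiableAt (o.mem_nhds hx)).hasDerivAt
  have m0 : (0:ℝ) ∈ Ioo p q := ⟨hp, hq⟩
  have d30 := d3 0 m0
  have p0 := hconv 0 m0
  generalize deriv (deriv (deriv f)) 0 = k at *
  obtain ⟨a, haa⟩ : ∃ a, a = deriv (deriv f) 0 / 2 := ⟨_, rfl⟩
  have h20 : deriv (deriv f) 0 = 2 * a := by rw [haa]; ring
  have ha : 0 < a := by rw [haa]; positivity
  rw [← haa]
  have hra : 0 < √a := Real.sqrt_pos.2 ha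
  have hra2 : √a ^ 2 = a := Real.sq_sqrt ha.le
  have fin : ∀ x, a * x^2 + (k/6) / a * x * f x + (k/6)^2 / (4 * a^3) * (f x)^2 - f x = 0 →
      a * x^2 - 2 * √a * (-k / (12 * a * √a)) * x * f x + (-k / (12 * a * √a))^2 * (f x)^2
        - f x = 0 := by
    intro x hx
    rw [← hx]
    have e1 : 2 * √a * (-k / (12 * a * √a)) = -((k/6) / a) := by field_simp; ring
    have e2 : (-k / (12 * a * √a))^2 = (k/6)^2 / (4 * a^3) := by
      rw [div_pow, mul_pow, mul_pow, hra2]; field_simp; ring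
    rw [e1, e2]; ring
  intro x hx
  apply fin
  rcases lt_trichotomy x 0 with h | h | h
  · have mm : ∀ y ∈ Ico 0 (-p), -y ∈ Ioo p q := fun y hy =>
      ⟨by linarith [hy.2], by linarith [hy.1]⟩
    have := pos_side (-p) a (-(k/6)) ha (fun y => f (-y)) (fun y => -deriv f (-y))
      (fun y => deriv (deriv f) (-y))
      (fun y hy => by
        exact ((d1 (-y) (mm y hy)).comp y (hasDerivAt_neg y)).congr_deriv (by simp))
      (fun y hy => by
        exact ((d2 (-y) (mm y hy)).comp y (hasDerivAt_neg y)).neg.congr_deriv (by simp))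
      (by simpa using h20)
      (by
        have d30' : HasDerivAt (deriv (deriv f)) k (-0) := by simpa using d30
        exact (d30'.comp (0:ℝ) (hasDerivAt_neg (0:ℝ))).congr_deriv (by ring))
      (by simpa using hf0) (by simpa using hf'0)
      (fun y hy => hconv _ (mm y hy))
      (fun s t hs hst ht => by
        have := hUT (-s) (mm s ⟨hs.le, hst.trans ht⟩) (-t) (mm t ⟨(hs.trans hst).le, ht⟩)
          (Or.inr ⟨by linarith, by linarith⟩)
        rw [abs_div] at this ⊢
        rw [← abs_neg (-s * _ - _)] at this
        have e1 : ((t - s) * -deriv f (-t) * -deriv f (-s) + f (-s) * -deriv f (-t) -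
            -deriv f (-s) * f (-t))^2 = ((-t - -s) * deriv f (-t) * deriv f (-s) +
            f (-s) * deriv f (-t) - deriv f (-s) * f (-t))^2 := by ring
        have e2 : -deriv f (-s) * -deriv f (-t) * (-deriv f (-t) - -deriv f (-s)) =
            -(deriv f (-s) * deriv f (-t) * (deriv f (-t) - deriv f (-s))) := by ring
        have e3 : s * f (-t) - t * f (-s) = -(-s * f (-t) - -t * f (-s)) := by ring
        rw [e1, e2, e3, abs_neg (deriv f (-s) * deriv f (-t) * _)]
        exact this)
      (-x) ⟨by linarith, by linarith [hx.1]⟩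
    simp only [neg_neg] at this
    rw [← this]; ring
  · subst h; simp [hf0]
  · have mm : ∀ y ∈ Ico 0 q, y ∈ Ioo p q := fun y hy => ⟨hp.trans_le hy.1, hy.2⟩
    exact pos_side q a (k/6) ha f (deriv f) (deriv (deriv f))
      (fun y hy => d1 y (mm y hy)) (fun y hy => d2 y (mm y hy)) h20
      (d30.congr_deriv (by ring)) hf0 hf'0 (fun y hy => hconv y (mm y hy))
      (fun s t hs hst ht => hUT s (mm s ⟨hs.le, hst.trans ht⟩) t (mm t ⟨(hs.trans hst).le, ht⟩)
        (Or.inl ⟨hs, hst⟩)) x ⟨h, hx.2⟩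
end

section
/- Let a, b > 0 with a ≠ b, and let f(x) = a x² for x < 0 and f(x) = b x² for x ≥ 0. For every h > 0, set s := −√(h/a) and t := √(h/b), so that (s, h) and (t, h) are the two points where the line y = h meets the graph of f, and the slopes of f at these points are f'(s) = −2√(a h) and f'(t) = 2√(b h). Then the area U_P(h) := (1/2)[ h²(f'(t) − f'(s))/(−f'(s) f'(t)) − 2h(t − s) + (−f'(s) f'(t))(t − s)²/(f'(t) − f'(s)) ] of the triangle bounded by the x-axis and the tangent lines to the graph at (s,h) and (t,h) equals half of the area T_P(h) := (h/2)(t − s) of the triangle with vertices (0,0), (s,h), (t,h); that is, U_P(h) = T_P(h)/2 for all h > 0. (Thus this non-parabola C¹ convex curve satisfies the area relation U_P(h) = T_P(h)/2 at the origin for all h > 0.) -/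
open Real Filter Set

theorem stmt_19 (a b : ℝ) (ha : 0 < a) (hb : 0 < b) (hab : a ≠ b)
    (f : ℝ → ℝ) (hf : f = fun x => if x < 0 then a * x^2 else b * x^2)
    (h : ℝ) (hh : 0 < h)
    (s t : ℝ) (hs : s = -Real.sqrt (h / a)) (ht : t = Real.sqrt (h / b)) :
    f s = h ∧ f t = h ∧
    deriv f s = -(2 * Real.sqrt (a * h)) ∧ deriv f t = 2 * Real.sqrt (b * h) ∧
    (1/2) * (h^2 * (deriv f t - deriv f s) / (-(deriv f s * deriv f t)) -
        2 * h * (t - s) +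
        (-(deriv f s * deriv f t)) * (t - s)^2 / (deriv f t - deriv f s)) =
      (h / 2 * (t - s)) / 2 := by
  obtain ⟨p, hp⟩ : ∃ p, p = Real.sqrt (h / a) := ⟨_, rfl⟩
  obtain ⟨q, hq⟩ : ∃ q, q = Real.sqrt (h / b) := ⟨_, rfl⟩
  have hp0 : 0 < p := by rw [hp]; positivity
  have hq0 : 0 < q := by rw [hq]; positivity
  have hp2 : p ^ 2 = h / a := by rw [hp]; exact Real.sq_sqrt (by positivity)
  have hq2 : q ^ 2 = h / b := by rw [hq]; exact Real.sq_sqrt (by positivity)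
  have hpa : a * p ^ 2 = h := by rw [hp2]; field_simp
  have hqb : b * q ^ 2 = h := by rw [hq2]; field_simp
  have hsa : Real.sqrt (a * h) = a * p := by
    rw [← hpa, show a * (a * p ^ 2) = (a * p) ^ 2 by ring]
    exact Real.sqrt_sq (by positivity)
  have hsb : Real.sqrt (b * h) = b * q := by
    rw [← hqb, show b * (b * q ^ 2) = (b * q) ^ 2 by ring]
    exact Real.sqrt_sq (by positivity)
  rw [← hp] at hs
  rw [← hq] at ht
  have hs0 : s < 0 := by linarith
  have ht0 : 0 < t := by linarith
  have key : ∀ c x : ℝ, HasDerivAt (fun y : ℝ => c * y ^ 2) (2 * c * x) x := by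
    intro c x
    have := (hasDerivAt_pow 2 x).const_mul c
    have e : c * (((2 : ℕ) : ℝ) * x ^ (2 - 1)) = 2 * c * x := by
      norm_num
      ring
    rw [← e]
    exact this
  have hds : deriv f s = -(2 * (a * p)) := by
    have e : f =ᶠ[nhds s] fun y : ℝ => a * y ^ 2 := by
      filter_upwards [Iio_mem_nhds hs0] with y hy
      have hy' : y < 0 := hy
      simp [hf, hy']
    rw [e.deriv_eq, (key a s).deriv, hs]
    ring
  have hdt : deriv f t = 2 * (b * q) := by
    have e : f =ᶠ[nhds t] fun y : ℝ => b * y ^ 2 := by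
      filter_upwards [Ioi_mem_nhds ht0] with y hy
      have hy' : ¬ y < 0 := not_lt.mpr (le_of_lt hy)
      simp [hf, hy']
    rw [e.deriv_eq, (key b t).deriv, ht]
    ring
  refine ⟨?_, ?_, ?_, ?_, ?_⟩
  · rw [hf]
    simp only [hs0, if_true]
    rw [hs, neg_sq, hpa]
  · rw [hf]
    simp only [not_lt.mpr ht0.le, if_false]
    rw [ht, hqb]
  · rw [hds, hsa]
  · rw [hdt, hsb]
  · have h1 : a * p = h / p := by rw [← hpa]; field_simp
    have h2 : b * q = h / q := by rw [← hqb]; field_simp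
    rw [hds, hdt, h1, h2, hs, ht]
    have e1 : 2 * (h / q) - -(2 * (h / p)) = 2 * h * (p + q) / (p * q) := by
      field_simp
      ring
    have e2 : -(-(2 * (h / p)) * (2 * (h / q))) = 4 * h ^ 2 / (p * q) := by
      field_simp
      ring
    rw [e1, e2]
    have hpq : p + q ≠ 0 := by positivity
    field_simp
    ring
end
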